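/- Let G be a subgraph of a fullerene graph F_n with n ≥ 40. If G contains R_5⁻ as a subgraph, then G is not extremal, where R_5⁻ is the pentagonal fragment obtained from the pentagonal ring R_5 by deleting one 2-degree vertex together with its two incident edges. -/

import Mathlib

namespace FG

/-- A combinatorial plane (spherically embedded) graph: a finite simple graph together with
its collection of faces, each face recorded as the finset of edges of its boundary cycle.
Every face boundary is a cycle, every edge lies on exactly two faces, and Euler's formula
holds (edges are counted via the face incidences). -/
structure PlaneGraph (V : Type) [Fintype V] [DecidableEq V] : Type where
  graph : SimpleGraph V
  faces : Finset (Finset (Sym2 V))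
  face_edges : ∀ f ∈ faces, ∀ e ∈ f, e ∈ graph.edgeSet
  face_cycle : ∀ f ∈ faces, ∃ (v : V) (c : graph.Walk v v), c.IsCycle ∧ c.edges.toFinset = f
  edge_faces : ∀ e ∈ graph.edgeSet, (faces.filter (fun f => e ∈ f)).card = 2
  euler : 2 * (Fintype.card V + faces.card) = (∑ f ∈ faces, f.card) + 4

variable {V : Type} [Fintype V] [DecidableEq V]

/-- The vertices incident with at least one edge of an edge set. -/
def edgeVerts (E : Finset (Sym2 V)) : Finset V :=
  Finset.univ.filter fun v => ∃ e ∈ E, v ∈ e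

/-- The degree of a vertex in the subgraph spanned by an edge set. -/
def deg (E : Finset (Sym2 V)) (v : V) : ℕ := (E.filter fun e => v ∈ e).card

/-- The vertices covered by a collection of faces. -/
def facesVerts (H : Finset (Finset (Sym2 V))) : Finset V := edgeVerts (H.sup id)

/-- An edge set is a matching: non-loop edges, pairwise vertex-disjoint. -/
def IsMatching (M : Finset (Sym2 V)) : Prop :=
  (∀ e ∈ M, ¬e.IsDiag) ∧ ∀ e ∈ M, ∀ e' ∈ M, e ≠ e' → ∀ v : V, v ∈ e → v ∉ e'

/-- A fullerene graph: a cubic 3-connected plane graph with (exactly 12) pentagonal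
faces and hexagonal faces. -/
structure IsFullerene (P : PlaneGraph V) : Prop where
  cubic : ∀ v : V, (P.graph.neighborSet v).ncard = 3
  threeConnected : ∀ s : Set V, s.ncard ≤ 2 → (SimpleGraph.induce sᶜ P.graph).Connected
  faceSize : ∀ f ∈ P.faces, f.card = 5 ∨ f.card = 6
  pentTwelve : (P.faces.filter fun f => f.card = 5).card = 12

/-- A fragment of a plane graph: a nonempty set of faces (a cycle together with its
interior) whose boundary — the set of edges lying on exactly one chosen face — is a
single cycle. -/
structure Fragment (P : PlaneGraph V) : Type where
  inFaces : Finset (Finset (Sym2 V))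
  nonempty : inFaces.Nonempty
  subFaces : inFaces ⊆ P.faces
  boundary_cycle : ∃ (v : V) (c : P.graph.Walk v v), c.IsCycle ∧
    c.edges.toFinset =
      (inFaces.sup id).filter fun e => (inFaces.filter fun f => e ∈ f).card = 1

/-- The edge set of a fragment. -/
def Fragment.edges {P : PlaneGraph V} (B : Fragment P) : Finset (Sym2 V) := B.inFaces.sup id

/-- The boundary edges of a fragment. -/
def Fragment.boundary {P : PlaneGraph V} (B : Fragment P) : Finset (Sym2 V) :=
  B.edges.filter fun e => (B.inFaces.filter fun f => e ∈ f).card = 1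

/-- A pentagonal fragment: all inner faces are pentagons. -/
def IsPentagonalFragment {P : PlaneGraph V} (B : Fragment P) : Prop :=
  ∀ f ∈ B.inFaces, f.card = 5

/-- The faces of `P` adjoining the subgraph with edge set `E`: not a face of the
subgraph, but sharing at least one edge with it. -/
def adjoiningFaces (P : PlaneGraph V) (E : Finset (Sym2 V)) : Finset (Finset (Sym2 V)) :=
  P.faces.filter fun f => ¬f ⊆ E ∧ (f ∩ E).Nonempty

/-- The territory `T[G]` of the subgraph with edge set `E`: the subgraph together with
all adjoining faces. -/
def territoryEdges (P : PlaneGraph V) (E : Finset (Sym2 V)) : Finset (Sym2 V) :=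
  E ∪ (adjoiningFaces P E).sup id

/-- `w(G)`: the number of 2-degree vertices of the subgraph spanned by `E`. -/
def wcount (E : Finset (Sym2 V)) : ℕ := ((edgeVerts E).filter fun v => deg E v = 2).card

/-- A subgraph is maximal in `P` when its hexagon extension is contained in `P`,
i.e. every adjoining face is a hexagon. -/
def IsMaximalIn (P : PlaneGraph V) (E : Finset (Sym2 V)) : Prop :=
  ∀ f ∈ adjoiningFaces P E, f.card = 6

/-- `H ∈ 𝒮(G)` for the subgraph `G` with edge set `E`: `H` is a set of mutually disjoint
hexagons of the hexagon extension `H[G]` (hexagonal faces sharing at least one edge with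
`G`) such that `G − H` has a matching covering all remaining 3-degree vertices of `G`. -/
def SextetAdm (P : PlaneGraph V) (E : Finset (Sym2 V)) (H : Finset (Finset (Sym2 V))) : Prop :=
  (∀ f ∈ H, f ∈ P.faces ∧ f.card = 6 ∧ (f ∩ E).Nonempty) ∧
  (∀ f ∈ H, ∀ g ∈ H, f ≠ g → Disjoint (edgeVerts f) (edgeVerts g)) ∧
  ∃ M : Finset (Sym2 V), M ⊆ E ∧ IsMatching M ∧
    (∀ e ∈ M, ∀ v : V, v ∈ e → v ∉ facesVerts H) ∧
    ∀ v ∈ edgeVerts E, deg E v = 3 → v ∉ facesVerts H → ∃ e ∈ M, v ∈ e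

/-- `U_H(G) = V(G) ∖ V(H)`. -/
def Uset (E : Finset (Sym2 V)) (H : Finset (Finset (Sym2 V))) : Finset V :=
  edgeVerts E \ facesVerts H

/-- A Clar set of `H[G]`: a member of `𝒮(G)` minimizing `|U_H(G)|`. -/
def IsClarSet (P : PlaneGraph V) (E : Finset (Sym2 V)) (H : Finset (Finset (Sym2 V))) : Prop :=
  SextetAdm P E H ∧ ∀ H', SextetAdm P E H' → (Uset E H).card ≤ (Uset E H').card

/-- A normal Clar set: a Clar set such that `G − H` has a perfect matching. -/
def IsNormalClarSet (P : PlaneGraph V) (E : Finset (Sym2 V))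
    (H : Finset (Finset (Sym2 V))) : Prop :=
  IsClarSet P E H ∧ ∃ M : Finset (Sym2 V), M ⊆ E ∧ IsMatching M ∧
    (∀ e ∈ M, ∀ v : V, v ∈ e → v ∉ facesVerts H) ∧
    ∀ v ∈ Uset E H, ∃ e ∈ M, v ∈ e

/-- The pentagonal faces of the subgraph with edge set `E`. -/
def pentFaces (P : PlaneGraph V) (E : Finset (Sym2 V)) : Finset (Finset (Sym2 V)) :=
  P.faces.filter fun f => f.card = 5 ∧ f ⊆ E

/-- A subgraph with `k` pentagons is extremal if `|U_H(G)| = k` for a Clar set `H`. -/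
def IsExtremalSub (P : PlaneGraph V) (E : Finset (Sym2 V)) : Prop :=
  ∃ H, IsClarSet P E H ∧ (Uset E H).card = (pentFaces P E).card

/-- A pentagonal ring `R_k`: `k` pentagonal faces `R 0, …, R (k-1)` such that
`R i` and `R j` intersect iff `|i − j| = 1 (mod k)`. -/
def IsPentRing (P : PlaneGraph V) (k : ℕ) (R : ZMod k → Finset (Sym2 V)) : Prop :=
  Function.Injective R ∧ (∀ i, R i ∈ P.faces ∧ (R i).card = 5) ∧
  ∀ i j : ZMod k, i ≠ j →
    ((edgeVerts (R i) ∩ edgeVerts (R j)).Nonempty ↔ (j = i + 1 ∨ i = j + 1))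

/-- The number of pentagons of the pentagonal fragment `B` adjoining (sharing an edge
with) the pentagon `p`. -/
def pentAdjCount {P : PlaneGraph V} (B : Fragment P) (p : Finset (Sym2 V)) : ℕ :=
  (B.inFaces.filter fun q => q ≠ p ∧ (q ∩ p).Nonempty).card

/-- The fragment consisting of a single pentagon `P`. -/
def IsPentagonFrag {P : PlaneGraph V} (B : Fragment P) : Prop :=
  IsPentagonalFragment B ∧ B.inFaces.card = 1

/-- `B_2`: the extremal pentagonal fragment with 4 pentagons whose Clar extension is
normal. -/
def IsB2Frag {P : PlaneGraph V} (B : Fragment P) : Prop :=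
  IsPentagonalFragment B ∧ B.inFaces.card = 4 ∧ IsExtremalSub P B.edges ∧
    ∃ H, IsNormalClarSet P B.edges H

/-- `B_3`: the extremal pentagonal fragment with 6 pentagons whose Clar extension is
normal. -/
def IsB3Frag {P : PlaneGraph V} (B : Fragment P) : Prop :=
  IsPentagonalFragment B ∧ B.inFaces.card = 6 ∧ IsExtremalSub P B.edges ∧
    ∃ H, IsNormalClarSet P B.edges H

/-- A pasting edge of the subgraph with edge set `E`: an edge of `E` lying on the
boundary of the Clar extension `C[G]` (not an edge of a Clar hexagon) whose two
end-vertices belong to `V(H)` for a Clar set `H`. -/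
def IsPastingEdge (P : PlaneGraph V) (E : Finset (Sym2 V)) (e : Sym2 V) : Prop :=
  e ∈ E ∧ ∃ H, IsClarSet P E H ∧ (∀ v : V, v ∈ e → v ∈ facesVerts H) ∧ e ∉ H.sup id

/-- `B` arises from pasting `A` and `C` along a common pasting edge:
`B = A ∪ C` and `A ∩ C` is a single pasting edge of both. -/
def IsPasting {P : PlaneGraph V} (B A C : Fragment P) : Prop :=
  B.inFaces = A.inFaces ∪ C.inFaces ∧
  ∃ e : Sym2 V, A.edges ∩ C.edges = {e} ∧ IsPastingEdge P A.edges e ∧ IsPastingEdge P C.edges e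

def IsBasicFrag {P : PlaneGraph V} (B : Fragment P) : Prop :=
  IsPentagonFrag B ∨ IsB2Frag B ∨ IsB3Frag B

/-- The pentagonal fragments generated from `P`, `B_2`, `B_3` by the pasting operation. -/
inductive Pasted (P : PlaneGraph V) : Fragment P → Prop
  | base (B : Fragment P) : IsBasicFrag B → Pasted P B
  | paste (B A C : Fragment P) : Pasted P A → IsBasicFrag C → IsPasting B A C → Pasted P B

/-- `P ∗ P`. -/
def IsPPFrag {P : PlaneGraph V} (B : Fragment P) : Prop :=
  ∃ A C : Fragment P, IsPentagonFrag A ∧ IsPentagonFrag C ∧ IsPasting B A C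

/-- `P ∗ B_2`. -/
def IsPB2Frag {P : PlaneGraph V} (B : Fragment P) : Prop :=
  ∃ A C : Fragment P, IsPentagonFrag A ∧ IsB2Frag C ∧ IsPasting B A C

/-- `P ∗ B_2 ∗ P`. -/
def IsPB2PFrag {P : PlaneGraph V} (B : Fragment P) : Prop :=
  ∃ B' A C D : Fragment P, IsPentagonFrag A ∧ IsB2Frag C ∧ IsPentagonFrag D ∧
    IsPasting B' A C ∧ IsPasting B B' D

/-- The six members of `𝓑_{≥60}`. -/
def SixShapes {P : PlaneGraph V} (B : Fragment P) : Prop :=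
  IsPentagonFrag B ∨ IsB2Frag B ∨ IsB3Frag B ∨ IsPPFrag B ∨ IsPB2Frag B ∨ IsPB2PFrag B

/-- `B_1`: two vertex-disjoint pentagons joined by an edge. -/
def IsB1 (P : PlaneGraph V) (E : Finset (Sym2 V)) : Prop :=
  ∃ (f g : Finset (Sym2 V)) (a b : V), f ∈ P.faces ∧ g ∈ P.faces ∧ f.card = 5 ∧ g.card = 5 ∧
    Disjoint (edgeVerts f) (edgeVerts g) ∧ P.graph.Adj a b ∧
    a ∈ edgeVerts f ∧ b ∈ edgeVerts g ∧ E = f ∪ g ∪ {s(a, b)}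

/-- `B_1^k`: `k` copies of `B_1` pasted together along pasting edges of their pentagons. -/
inductive B1Pow (P : PlaneGraph V) : ℕ → Finset (Sym2 V) → Prop
  | one (E : Finset (Sym2 V)) : IsB1 P E → B1Pow P 1 E
  | succ (k : ℕ) (E X : Finset (Sym2 V)) (e : Sym2 V) (f g : Finset (Sym2 V)) :
      B1Pow P k E → IsB1 P X → E ∩ X = {e} → f ∈ P.faces → g ∈ P.faces →
      f.card = 5 → g.card = 5 → f ⊆ E → g ⊆ X → e ∈ f → e ∈ g →
      IsPastingEdge P f e → IsPastingEdge P g e → B1Pow P (k + 1) (E ∪ X)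

/-- `F` contains `B_1^k` for some `2 ≤ k ≤ 4` as a subgraph. -/
def ContainsB1Pow (P : PlaneGraph V) : Prop :=
  ∃ (k : ℕ) (E : Finset (Sym2 V)), 2 ≤ k ∧ k ≤ 4 ∧ B1Pow P k E

/-- A perfect matching of the plane graph `P`. -/
def IsPerfectMatching (P : PlaneGraph V) (M : Finset (Sym2 V)) : Prop :=
  (∀ e ∈ M, e ∈ P.graph.edgeSet) ∧ IsMatching M ∧ ∀ v : V, ∃ e ∈ M, v ∈ e

/-- A sextet pattern of `P`: mutually disjoint hexagonal faces, all alternating with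
respect to a common perfect matching. -/
def IsSextetPattern (P : PlaneGraph V) (H : Finset (Finset (Sym2 V))) : Prop :=
  (∀ f ∈ H, f ∈ P.faces ∧ f.card = 6) ∧
  (∀ f ∈ H, ∀ g ∈ H, f ≠ g → Disjoint (edgeVerts f) (edgeVerts g)) ∧
  ∃ M : Finset (Sym2 V), IsPerfectMatching P M ∧ ∀ f ∈ H, (f ∩ M).card = 3

/-- A Clar formula: a maximum sextet pattern. -/
def IsClarFormula (P : PlaneGraph V) (H : Finset (Finset (Sym2 V))) : Prop :=
  IsSextetPattern P H ∧ ∀ H', IsSextetPattern P H' → H'.card ≤ H.card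

/-- An extremal fullerene graph: the Clar number equals `(n − 12)/6`. -/
def IsExtremalFullerene (P : PlaneGraph V) : Prop :=
  ∃ H, IsClarFormula P H ∧ 6 * H.card = Fintype.card V - 12

/-- The edges of the union of all maximal pentagonal fragments of `P`. -/
noncomputable def maxPentEdges (P : PlaneGraph V) : Finset (Sym2 V) :=
  @Finset.filter _
    (fun e => ∃ B : Fragment P, IsPentagonalFragment B ∧ IsMaximalIn P B.edges ∧ e ∈ B.edges)
    (Classical.decPred _) (P.faces.sup id)

/-- The disjoint union of two copies of `K_2`. -/
def twoK2 : SimpleGraph (Fin 4) := SimpleGraph.fromEdgeSet {s(0, 1), s(2, 3)}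

/-- The tree `T_0` on six vertices: two adjacent 3-degree vertices, each also adjacent
to two leaves. -/
def treeT0 : SimpleGraph (Fin 6) :=
  SimpleGraph.fromEdgeSet {s(0, 1), s(0, 2), s(0, 3), s(1, 4), s(1, 5)}


theorem mem_edgeVerts {E : Finset (Sym2 V)} {x : V} :
    x ∈ edgeVerts E ↔ ∃ e ∈ E, x ∈ e := by
  simp [edgeVerts]

theorem mem_ev_left {E : Finset (Sym2 V)} {x y : V} (h : s(x, y) ∈ E) : x ∈ edgeVerts E :=
  mem_edgeVerts.2 ⟨_, h, by simp⟩

theorem mem_ev_right {E : Finset (Sym2 V)} {x y : V} (h : s(x, y) ∈ E) : y ∈ edgeVerts E :=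
  mem_edgeVerts.2 ⟨_, h, by simp⟩

theorem mem_facesVerts {H : Finset (Finset (Sym2 V))} {x : V} :
    x ∈ facesVerts H ↔ ∃ h ∈ H, x ∈ edgeVerts h := by
  simp only [facesVerts, mem_edgeVerts, Finset.mem_sup, id]
  constructor
  · rintro ⟨e, ⟨h, hh, he⟩, hx⟩
    exact ⟨h, hh, e, he, hx⟩
  · rintro ⟨h, hh, e, he, hx⟩
    exact ⟨e, ⟨h, hh, he⟩, hx⟩

theorem face_deg (P : PlaneGraph V) {f : Finset (Sym2 V)} (hf : f ∈ P.faces) {x : V}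
    (hx : x ∈ edgeVerts f) : deg f x = 2 := by
  obtain ⟨v, c, hc, rfl⟩ := P.face_cycle f hf
  have hx' : x ∈ c.support := by
    obtain ⟨e, he, hxe⟩ := mem_edgeVerts.1 hx
    exact SimpleGraph.Walk.mem_support_of_mem_edges (by simpa using he) hxe
  have h2 := hc.ncard_neighborSet_toSubgraph_eq_two hx'
  rw [deg, ← Set.ncard_coe_finset, ← h2]
  symm
  refine Set.ncard_congr (fun y _ => s(x, y)) ?_ ?_ ?_
  · intro y hy
    simp only [SimpleGraph.Subgraph.mem_neighborSet, SimpleGraph.Walk.adj_toSubgraph_iff_mem_edges] at hy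
    simp [hy]
  · intro y z _ _ h
    exact Sym2.congr_right.1 h
  · intro e he
    simp only [Finset.coe_filter, List.mem_toFinset, Set.mem_ofPred_eq] at he
    obtain ⟨he, hxe⟩ := he
    obtain ⟨y, rfl⟩ := hxe
    refine ⟨y, ?_, rfl⟩
    simp only [SimpleGraph.Subgraph.mem_neighborSet, SimpleGraph.Walk.adj_toSubgraph_iff_mem_edges]
    exact he

/-- A vertex set closed under adjacency along a face contains the whole face. -/
theorem face_closed (P : PlaneGraph V) {f : Finset (Sym2 V)} (hf : f ∈ P.faces)
    (S : Finset V) {x : V} (hx : x ∈ edgeVerts f) (hxS : x ∈ S)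
    (hS : ∀ y z, s(y, z) ∈ f → y ∈ S → z ∈ S) : edgeVerts f ⊆ S := by
  obtain ⟨v, c, hc, rfl⟩ := P.face_cycle f hf
  have key : ∀ {u w : V} (p : P.graph.Walk u w), (∀ e ∈ p.edges, e ∈ c.edges) →
      (∃ t ∈ p.support, t ∈ S) → ∀ t ∈ p.support, t ∈ S := by
    intro u w p
    induction p with
    | nil => simp
    | @cons u z w h p ih =>
      intro he hex t ht
      simp only [SimpleGraph.Walk.edges_cons, List.mem_cons, forall_eq_or_imp] at he
      have huz : u ∈ S ↔ z ∈ S :=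
        ⟨hS u z (by simpa using he.1), hS z u (by rw [Sym2.eq_swap]; simpa using he.1)⟩
      simp only [SimpleGraph.Walk.support_cons, List.mem_cons] at hex ht
      have hex' : ∃ t ∈ p.support, t ∈ S := by
        obtain ⟨t', ht' | ht', hS'⟩ := hex
        · subst ht'
          exact ⟨z, p.start_mem_support, huz.1 hS'⟩
        · exact ⟨t', ht', hS'⟩
      have := ih he.2 hex'
      rcases ht with rfl | ht
      · exact huz.2 (this z p.start_mem_support)
      · exact this t ht
  have supp : ∀ t ∈ edgeVerts c.edges.toFinset, t ∈ c.support := by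
    intro t ht
    obtain ⟨e, he, hte⟩ := mem_edgeVerts.1 ht
    exact SimpleGraph.Walk.mem_support_of_mem_edges (by simpa using he) hte
  intro t ht
  exact key c (fun e he => he) ⟨x, supp x hx, hxS⟩ t (supp t ht)

theorem face_not_diag (P : PlaneGraph V) {f : Finset (Sym2 V)} (hf : f ∈ P.faces)
    {e : Sym2 V} (he : e ∈ f) : ¬ e.IsDiag :=
  P.graph.not_isDiag_of_mem_edgeSet (P.face_edges f hf e he)

theorem face_ne (P : PlaneGraph V) {f : Finset (Sym2 V)} (hf : f ∈ P.faces)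
    {x y : V} (he : s(x, y) ∈ f) : x ≠ y := by
  have := face_not_diag P hf he
  simpa using this

theorem card_filter_mem_edge {e : Sym2 V} (he : ¬ e.IsDiag) :
    (Finset.univ.filter fun x => x ∈ e).card = 2 := by
  induction e with
  | h x y =>
    have hxy : x ≠ y := by simpa using he
    have : (Finset.univ.filter fun z => z ∈ s(x, y)) = {x, y} := by
      ext z; simp
    rw [this, Finset.card_pair hxy]

theorem face_card_verts (P : PlaneGraph V) {f : Finset (Sym2 V)} (hf : f ∈ P.faces) :
    (edgeVerts f).card = f.card := by
  have h := Finset.sum_card_bipartiteAbove_eq_sum_card_bipartiteBelow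
    (s := (Finset.univ : Finset V)) (t := f) (fun x e => x ∈ e)
  have h1 : ∑ x : V, (f.bipartiteAbove (fun x e => x ∈ e) x).card = 2 * (edgeVerts f).card := by
    rw [mul_comm, ← smul_eq_mul, ← Finset.sum_const]
    symm
    rw [← Finset.sum_subset (Finset.subset_univ (edgeVerts f))]
    · refine Finset.sum_congr rfl fun x hx => ?_
      exact (face_deg P hf hx).symm
    · intro x _ hx
      rw [Finset.card_eq_zero]
      refine Finset.eq_empty_of_forall_notMem fun e he => hx ?_
      simp only [Finset.bipartiteAbove, Finset.mem_filter] at he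
      exact mem_edgeVerts.2 ⟨e, he⟩
  have h2 : ∑ e ∈ f, ((Finset.univ : Finset V).bipartiteBelow (fun x e => x ∈ e) e).card
      = 2 * f.card := by
    rw [mul_comm, ← smul_eq_mul, ← Finset.sum_const]
    refine Finset.sum_congr rfl fun e he => ?_
    exact card_filter_mem_edge (face_not_diag P hf he)
  omega

open Classical in
/-- Edges of the graph at a vertex. -/
noncomputable def Inc (P : PlaneGraph V) (x : V) : Finset (Sym2 V) :=
  Finset.univ.filter fun e => e ∈ P.graph.edgeSet ∧ x ∈ e

theorem mem_Inc {P : PlaneGraph V} {x : V} {e : Sym2 V} :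
    e ∈ Inc P x ↔ e ∈ P.graph.edgeSet ∧ x ∈ e := by
  simp [Inc]

theorem Inc_card {P : PlaneGraph V} (hP : IsFullerene P) (x : V) : (Inc P x).card = 3 := by
  rw [← hP.cubic x, ← Set.ncard_coe_finset]
  symm
  refine Set.ncard_congr (fun y _ => s(x, y)) ?_ ?_ ?_
  · intro y hy
    simp only [SimpleGraph.mem_neighborSet] at hy
    simp [mem_Inc, hy]
  · intro y z _ _ h
    exact Sym2.congr_right.1 h
  · intro e he
    rw [Finset.mem_coe, mem_Inc] at he
    obtain ⟨he, y, rfl⟩ := he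
    exact ⟨y, he, rfl⟩

/-- No three distinct faces contain a common edge. -/
theorem face_two (P : PlaneGraph V) {f g h : Finset (Sym2 V)} (hf : f ∈ P.faces)
    (hg : g ∈ P.faces) (hh : h ∈ P.faces) {e : Sym2 V} (ef : e ∈ f) (eg : e ∈ g) (eh : e ∈ h)
    (hfg : f ≠ g) (hfh : f ≠ h) : g = h := by
  by_contra hgh
  have h2 := P.edge_faces e (P.face_edges f hf e ef)
  have : ({f, g, h} : Finset _) ⊆ P.faces.filter (fun f => e ∈ f) := by
    intro k hk
    simp only [Finset.mem_insert, Finset.mem_singleton] at hk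
    rcases hk with rfl | rfl | rfl <;> simp [*]
  have := Finset.card_le_card this
  rw [Finset.card_eq_three.2 ⟨f, g, h, hfg, hfh, hgh, rfl⟩] at this
  omega

theorem other_face (P : PlaneGraph V) {f : Finset (Sym2 V)} {e : Sym2 V}
    (he : e ∈ P.graph.edgeSet) : ∃ g ∈ P.faces, e ∈ g ∧ g ≠ f := by
  have h2 := P.edge_faces e he
  obtain ⟨g, hg, hgf⟩ := Finset.exists_mem_ne
    (by omega : 1 < (P.faces.filter (fun f => e ∈ f)).card) f
  simp only [Finset.mem_filter] at hg
  exact ⟨g, hg.1, hg.2, hgf⟩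

theorem face_filter (P : PlaneGraph V) {f : Finset (Sym2 V)} (hf : f ∈ P.faces) {x : V}
    (hx : x ∈ edgeVerts f) :
    ∃ A ⊆ Inc P x, A.card = 2 ∧ ∀ e, x ∈ e → (e ∈ f ↔ e ∈ A) := by
  refine ⟨f.filter (fun e => x ∈ e), ?_, face_deg P hf hx, ?_⟩
  · intro e he
    simp only [Finset.mem_filter] at he
    exact mem_Inc.2 ⟨P.face_edges f hf e he.1, he.2⟩
  · intro e he
    simp [he]

/-- If `a ≠ b` are edges of `f` at `x`, these are all of them. -/
theorem face_only (P : PlaneGraph V) {f : Finset (Sym2 V)} (hf : f ∈ P.faces) {x : V}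
    {a b e : Sym2 V} (ha : a ∈ f) (hb : b ∈ f) (he : e ∈ f) (hab : a ≠ b)
    (xa : x ∈ a) (xb : x ∈ b) (xe : x ∈ e) : e = a ∨ e = b := by
  have h2 := face_deg P hf (mem_edgeVerts.2 ⟨a, ha, xa⟩)
  by_contra hcon
  push Not at hcon
  have : ({e, a, b} : Finset _) ⊆ f.filter (fun e => x ∈ e) := by
    intro k hk
    simp only [Finset.mem_insert, Finset.mem_singleton] at hk
    rcases hk with rfl | rfl | rfl <;> simp [*]
  have := Finset.card_le_card this
  rw [Finset.card_eq_three.2 ⟨e, a, b, hcon.1, hcon.2, hab, rfl⟩] at this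
  rw [deg] at h2
  omega

/-- The local structure at a cubic vertex. -/
theorem local_struct {P : PlaneGraph V} (hP : IsFullerene P) {f g : Finset (Sym2 V)}
    (hf : f ∈ P.faces) (hg : g ∈ P.faces) (hfg : f ≠ g) {x : V}
    (xf : x ∈ edgeVerts f) (xg : x ∈ edgeVerts g) :
    ∃ a b c, a ≠ b ∧ a ≠ c ∧ b ≠ c ∧ Inc P x = {a, b, c} ∧ a ∈ f ∧ a ∈ g ∧ b ∈ f ∧ b ∉ g ∧
      c ∉ f ∧ c ∈ g := by
  obtain ⟨A, hA, hA2, hAf⟩ := face_filter P hf xf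
  obtain ⟨B, hB, hB2, hBg⟩ := face_filter P hg xg
  have hI := Inc_card hP x
  -- pairs differ
  have hAB : A ≠ B := by
    rintro rfl
    have hc : ∃ c ∈ Inc P x, c ∉ A := by
      by_contra! hcon
      have := Finset.card_le_card (show Inc P x ⊆ A from hcon)
      omega
    obtain ⟨c, hc, hcA⟩ := hc
    obtain ⟨hce, hxc⟩ := mem_Inc.1 hc
    obtain ⟨r, hr, hcr, hrf⟩ := other_face P (f := f) hce
    have xr : x ∈ edgeVerts r := mem_edgeVerts.2 ⟨c, hcr, hxc⟩
    obtain ⟨C, hC, hC2, hCr⟩ := face_filter P hr xr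
    have : ∃ a ∈ C, a ≠ c := Finset.exists_mem_ne (by omega) c
    obtain ⟨a, haC, hac⟩ := this
    have hxa := (mem_Inc.1 (hC haC)).2
    have haA : a ∈ A := by
      by_contra haA
      have : ({a, c} : Finset _) ∪ A ⊆ Inc P x := by
        intro k hk
        simp only [Finset.mem_insert, Finset.mem_singleton, Finset.mem_union] at hk
        rcases hk with (rfl | rfl) | hk
        · exact hC haC
        · exact hc
        · exact hA hk
      have := Finset.card_le_card this
      rw [Finset.card_union_of_disjoint, Finset.card_pair hac] at this
      · omega
      · rw [Finset.disjoint_left]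
        intro k hk
        simp only [Finset.mem_insert, Finset.mem_singleton] at hk
        rcases hk with rfl | rfl <;> assumption
    have h1 := (hAf a hxa).2 haA
    have h2 := (hBg a hxa).2 haA
    have h3 := (hCr a hxa).2 haC
    have := face_two P hf hg hr h1 h2 h3 hfg hrf.symm
    subst this
    exact hcA ((hBg c hxc).1 hcr)
  have hb : ∃ b ∈ A, b ∉ B := by
    by_contra! hcon
    exact hAB (Finset.eq_of_subset_of_card_le hcon (by omega))
  have hc : ∃ c ∈ B, c ∉ A := by
    by_contra! hcon
    exact hAB (Finset.eq_of_subset_of_card_le hcon (by omega)).symm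
  obtain ⟨b, hbA, hbB⟩ := hb
  obtain ⟨c, hcB, hcA⟩ := hc
  obtain ⟨a, haA, hab⟩ := Finset.exists_mem_ne (by omega : 1 < A.card) b
  have hac : a ≠ c := by rintro rfl; exact hcA haA
  have hbc : b ≠ c := by rintro rfl; exact hcA hbA
  have hIn : Inc P x = {a, b, c} := by
    symm
    apply Finset.eq_of_subset_of_card_le
    · intro k hk
      simp only [Finset.mem_insert, Finset.mem_singleton] at hk
      rcases hk with rfl | rfl | rfl
      exacts [hA haA, hA hbA, hB hcB]
    · rw [Finset.card_eq_three.2 ⟨a, b, c, hab, hac, hbc, rfl⟩, hI]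
  have haB : a ∈ B := by
    by_contra haB
    obtain ⟨d, hd, hdc⟩ := Finset.exists_mem_ne (by omega : 1 < B.card) c
    have := hB hd
    rw [hIn] at this
    simp only [Finset.mem_insert, Finset.mem_singleton] at this
    rcases this with rfl | rfl | rfl <;> contradiction
  have xa := (mem_Inc.1 (hA haA)).2
  have xb := (mem_Inc.1 (hA hbA)).2
  have xc := (mem_Inc.1 (hB hcB)).2
  refine ⟨a, b, c, hab, hac, hbc, hIn, ?_, ?_, ?_, ?_, ?_, ?_⟩
  · exact (hAf a xa).2 haA
  · exact (hBg a xa).2 haB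
  · exact (hAf b xb).2 hbA
  · exact fun h => hbB ((hBg b xb).1 h)
  · exact fun h => hcA ((hAf c xc).1 h)
  · exact (hBg c xc).2 hcB

theorem common_edge {P : PlaneGraph V} (hP : IsFullerene P) {f g : Finset (Sym2 V)}
    (hf : f ∈ P.faces) (hg : g ∈ P.faces) (hfg : f ≠ g) {x : V}
    (xf : x ∈ edgeVerts f) (xg : x ∈ edgeVerts g) : ∃ e, x ∈ e ∧ e ∈ f ∧ e ∈ g := by
  obtain ⟨a, b, c, -, -, -, hI, haf, hag, -⟩ := local_struct hP hf hg hfg xf xg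
  exact ⟨a, (mem_Inc.1 (hI ▸ by simp : a ∈ Inc P x)).2, haf, hag⟩

theorem cover_edge {P : PlaneGraph V} (hP : IsFullerene P) {f g : Finset (Sym2 V)}
    (hf : f ∈ P.faces) (hg : g ∈ P.faces) (hfg : f ≠ g) {x : V}
    (xf : x ∈ edgeVerts f) (xg : x ∈ edgeVerts g) {e : Sym2 V} (he : e ∈ P.graph.edgeSet)
    (hx : x ∈ e) : e ∈ f ∨ e ∈ g := by
  obtain ⟨a, b, c, -, -, -, hI, haf, hag, hbf, -, -, hcg⟩ := local_struct hP hf hg hfg xf xg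
  have := mem_Inc.2 ⟨he, hx⟩
  rw [hI] at this
  simp only [Finset.mem_insert, Finset.mem_singleton] at this
  rcases this with rfl | rfl | rfl <;> simp [*]

/-- Third face at a vertex: contains the two non-common edges. -/
theorem third_edge {P : PlaneGraph V} (hP : IsFullerene P) {f g h : Finset (Sym2 V)}
    (hf : f ∈ P.faces) (hg : g ∈ P.faces) (hh : h ∈ P.faces)
    (hgh : g ≠ h) {x : V}
    (xg : x ∈ edgeVerts g) (xh : x ∈ edgeVerts h) {e : Sym2 V}
    (he : e ∈ f) (hx : x ∈ e) (heg : e ∉ g) : e ∈ h :=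
  (cover_edge hP hg hh hgh xg xh (P.face_edges f hf e he) hx).resolve_left heg

/-- At most three faces at a vertex. -/
theorem four_faces {P : PlaneGraph V} (hP : IsFullerene P) {f g h k : Finset (Sym2 V)}
    (hf : f ∈ P.faces) (hg : g ∈ P.faces) (hh : h ∈ P.faces) (hk : k ∈ P.faces)
    (hfg : f ≠ g) (hfh : f ≠ h) (hgh : g ≠ h) {x : V}
    (xf : x ∈ edgeVerts f) (xg : x ∈ edgeVerts g) (xh : x ∈ edgeVerts h)
    (xk : x ∈ edgeVerts k) : k = f ∨ k = g ∨ k = h := by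
  by_contra hcon
  push Not at hcon
  obtain ⟨e, hxe, hef, heg⟩ := common_edge hP hf hg hfg xf xg
  rcases cover_edge hP hh hk hcon.2.2.symm xh xk (P.face_edges f hf e hef) hxe with h1 | h1
  · exact hgh (face_two P hf hg hh hef heg h1 hfg hfh)
  · exact hcon.2.1 (face_two P hf hg hk hef heg h1 hfg hcon.1.symm).symm

theorem exists_third {P : PlaneGraph V} (hP : IsFullerene P) {f g : Finset (Sym2 V)}
    (hf : f ∈ P.faces) (hg : g ∈ P.faces) (hfg : f ≠ g) {x : V}
    (xf : x ∈ edgeVerts f) (xg : x ∈ edgeVerts g) :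
    ∃ h ∈ P.faces, h ≠ f ∧ h ≠ g ∧ x ∈ edgeVerts h := by
  obtain ⟨a, b, c, -, -, -, hI, haf, hag, hbf, hbg, -⟩ := local_struct hP hf hg hfg xf xg
  obtain ⟨h, hh, hbh, hne⟩ := other_face P (f := f) (P.face_edges f hf b hbf)
  refine ⟨h, hh, hne, ?_, mem_edgeVerts.2 ⟨b, hbh, (mem_Inc.1 (hI ▸ by simp : b ∈ Inc P x)).2⟩⟩
  rintro rfl
  exact hbg hbh

theorem const_of_connected {W α : Type*} {G : SimpleGraph W} (hG : G.Connected) (φ : W → α)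
    (h : ∀ x y, G.Adj x y → φ x = φ y) (x y : W) : φ x = φ y := by
  obtain ⟨p⟩ := hG.preconnected x y
  induction p with
  | nil => rfl
  | cons hadj _ ih => exact (h _ _ hadj).trans ih

theorem graph_const {P : PlaneGraph V} (hP : IsFullerene P) {α : Type*} (s : Set V)
    (hs : s.ncard ≤ 2) (φ : V → α)
    (h : ∀ x y, x ∉ s → y ∉ s → P.graph.Adj x y → φ x = φ y) {x y : V} (hx : x ∉ s) (hy : y ∉ s) :
    φ x = φ y :=
  const_of_connected (hP.threeConnected s hs) (fun z => φ z.1)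
    (fun a b hab => h a.1 b.1 a.2 b.2 hab) ⟨x, hx⟩ ⟨y, hy⟩

theorem exists_face_at {P : PlaneGraph V} (hP : IsFullerene P) (x : V) :
    ∃ f ∈ P.faces, x ∈ edgeVerts f := by
  have h3 := Inc_card hP x
  obtain ⟨e, he⟩ := Finset.card_pos.1 (by omega : 0 < (Inc P x).card)
  obtain ⟨he1, he2⟩ := mem_Inc.1 he
  obtain ⟨g, hg, heg, -⟩ := other_face P (f := ∅) he1
  exact ⟨g, hg, mem_edgeVerts.2 ⟨e, heg, he2⟩⟩

theorem face_has_vert {P : PlaneGraph V} (hP : IsFullerene P) {f : Finset (Sym2 V)}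
    (hf : f ∈ P.faces) : ∃ x, x ∈ edgeVerts f := by
  have h1 := face_card_verts P hf
  have h2 := hP.faceSize f hf
  exact Finset.card_pos.1 (by omega)

/-- The dual graph is connected: a function on faces agreeing on faces that share an edge
is constant. -/
theorem dual_const {P : PlaneGraph V} (hP : IsFullerene P) {α : Type*}
    (γ : Finset (Sym2 V) → α)
    (h : ∀ f ∈ P.faces, ∀ g ∈ P.faces, ∀ e, e ∈ f → e ∈ g → f ≠ g → γ f = γ g)
    {f g : Finset (Sym2 V)} (hf : f ∈ P.faces) (hg : g ∈ P.faces) : γ f = γ g := by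
  have hv : ∀ x : V, ∀ f ∈ P.faces, ∀ g ∈ P.faces, x ∈ edgeVerts f → x ∈ edgeVerts g →
      γ f = γ g := by
    intro x f hf g hg xf xg
    by_cases hfg : f = g
    · rw [hfg]
    obtain ⟨e, -, h1, h2⟩ := common_edge hP hf hg hfg xf xg
    exact h f hf g hg e h1 h2 hfg
  choose F hF hxF using exists_face_at hP
  obtain ⟨x, hx⟩ := face_has_vert hP hf
  obtain ⟨y, hy⟩ := face_has_vert hP hg
  have := graph_const hP ∅ (by simp) (fun z => γ (F z)) (by
    intro a b _ _ hab
    obtain ⟨k, hk, hek, -⟩ := other_face P (f := ∅) (e := s(a, b)) hab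
    exact (hv a _ (hF a) k hk (hxF a) (mem_ev_left hek)).trans
      (hv b _ hk _ (hF b) (mem_ev_right hek) (hxF b))) (x := x) (y := y) (by simp) (by simp)
  exact (hv x f hf _ (hF x) hx (hxF x)).trans (this.trans (hv y _ (hF y) g hg (hxF y) hy))

theorem zmod2_add_eq {a b : ZMod 2} (h : a + b = 0) : a = b := by
  revert a b; decide

theorem sum_edge {M : Type*} [AddCommMonoid M] (φ : V → M) {x y : V} (h : x ≠ y) :
    ∑ z ∈ Finset.univ.filter (fun z => z ∈ s(x, y)), φ z = φ x + φ y := by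
  have : (Finset.univ.filter fun z => z ∈ s(x, y)) = {x, y} := by
    ext z; simp
  rw [this, Finset.sum_pair h]

theorem sum_edges_eq {P : PlaneGraph V} :
    ∑ f ∈ P.faces, f.card = 2 * Nat.card P.graph.edgeSet := by
  classical
  have h := Finset.sum_card_bipartiteAbove_eq_sum_card_bipartiteBelow
    (s := P.graph.edgeFinset) (t := P.faces) (fun e f => e ∈ f)
  have h1 : ∑ e ∈ P.graph.edgeFinset, (P.faces.bipartiteAbove (fun e f => e ∈ f) e).card
      = 2 * P.graph.edgeFinset.card := by
    rw [mul_comm, ← smul_eq_mul, ← Finset.sum_const]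
    refine Finset.sum_congr rfl fun e he => ?_
    exact P.edge_faces e (by simpa using he)
  have h2 : ∑ f ∈ P.faces, (P.graph.edgeFinset.bipartiteBelow (fun e f => e ∈ f) f).card
      = ∑ f ∈ P.faces, f.card := by
    refine Finset.sum_congr rfl fun f hf => ?_
    congr 1
    ext e
    simp only [Finset.bipartiteBelow, Finset.mem_filter, SimpleGraph.mem_edgeFinset]
    exact ⟨fun h => h.2, fun h => ⟨P.face_edges f hf e h, h⟩⟩
  rw [Nat.card_eq_fintype_card, ← SimpleGraph.edgeFinset_card]
  omega

/-- Discrete Jordan theorem: an edge set meeting every face evenly is a cut. -/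
theorem exists_cut {P : PlaneGraph V} (hP : IsFullerene P) (S : Finset (Sym2 V))
    (hS : ∀ f ∈ P.faces, Even (f ∩ S).card) :
    ∃ φ : V → ZMod 2, ∀ x y, P.graph.Adj x y →
      φ x + φ y = if s(x, y) ∈ S then 1 else 0 := by
  classical
  let N : Matrix P.faces P.graph.edgeSet (ZMod 2) :=
    Matrix.of fun f e => if e.1 ∈ f.1 then 1 else 0
  let B : Matrix P.graph.edgeSet V (ZMod 2) :=
    Matrix.of fun e x => if x ∈ e.1 then 1 else 0
  have hBv : ∀ (φ : V → ZMod 2) (x y : V) (h : P.graph.Adj x y),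
      (B.mulVec φ) ⟨s(x, y), h⟩ = φ x + φ y := by
    intro φ x y h
    rw [← sum_edge φ h.ne]
    simp [B, Matrix.mulVec, dotProduct, Finset.sum_ite]
  have hNv : ∀ (c : Sym2 V → ZMod 2) (f : P.faces),
      (N.mulVec (fun e => c e.1)) f = ∑ e ∈ f.1, c e := by
    intro c f
    simp only [N, Matrix.mulVec, dotProduct, Matrix.of_apply, ite_mul, one_mul, zero_mul]
    rw [← Finset.sum_filter]
    refine Finset.sum_bij (fun e _ => e.1) ?_ ?_ ?_ ?_
    · intro e he; simpa using he
    · intro a _ b _ h; exact Subtype.ext h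
    · intro e he; exact ⟨⟨e, P.face_edges f.1 f.2 e he⟩, by simpa using he, rfl⟩
    · intro e he; rfl
  have hNB : N * B = 0 := by
    ext f x
    have := hNv (fun e => if x ∈ e then 1 else 0) f
    simp only [Matrix.mul_apply, Matrix.zero_apply]
    simp only [Matrix.mulVec, dotProduct] at this
    simp only [B, Matrix.of_apply]
    rw [this, Finset.sum_boole]
    by_cases hx : x ∈ edgeVerts f.1
    · have := face_deg P f.2 hx
      rw [deg] at this
      rw [this]; rfl
    · have : (f.1.filter fun e => x ∈ e) = ∅ := by
        refine Finset.eq_empty_of_forall_notMem fun e he => hx ?_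
        simp only [Finset.mem_filter] at he
        exact mem_edgeVerts.2 ⟨e, he⟩
      rw [this]; simp
  have hle : LinearMap.range B.mulVecLin ≤ LinearMap.ker N.mulVecLin := by
    rintro _ ⟨φ, rfl⟩
    simp [hNB]
  -- kernel of B
  have hkB : Module.finrank (ZMod 2) (LinearMap.ker B.mulVecLin) ≤ 1 := by
    refine finrank_le_one ⟨fun _ => 1, ?_⟩ ?_
    · rw [LinearMap.mem_ker]
      ext ⟨e, he⟩
      induction e with
      | h x y =>
        rw [Matrix.mulVecLin_apply, hBv _ x y he]; rfl
    · rintro ⟨φ, hφ⟩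
      rw [LinearMap.mem_ker, Matrix.mulVecLin_apply] at hφ
      by_cases hV : Nonempty V
      · obtain ⟨v⟩ := hV
        refine ⟨φ v, Subtype.ext ?_⟩
        ext x
        simp only [SetLike.mk_smul_mk, Pi.smul_apply, smul_eq_mul, mul_one]
        refine graph_const hP ∅ (by simp) φ ?_ (by simp) (by simp)
        intro a b _ _ hab
        have := congrFun hφ ⟨s(a, b), hab⟩
        rw [hBv _ a b hab] at this
        exact zmod2_add_eq this
      · exact ⟨0, Subtype.ext (funext fun x => (hV ⟨x⟩).elim)⟩
  -- kernel of Nᵀ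
  have hkN : Module.finrank (ZMod 2) (LinearMap.ker N.transpose.mulVecLin) ≤ 1 := by
    have hT : ∀ (γ : P.faces → ZMod 2) (e : P.graph.edgeSet) (f g : P.faces), f ≠ g →
        e.1 ∈ f.1 → e.1 ∈ g.1 → (N.transpose.mulVec γ) e = γ f + γ g := by
      intro γ e f g hfg hef heg
      simp only [N, Matrix.mulVec, dotProduct, Matrix.transpose_apply, Matrix.of_apply, ite_mul,
        one_mul, zero_mul]
      rw [← Finset.sum_filter]
      have : (Finset.univ.filter fun k : P.faces => e.1 ∈ k.1) = {f, g} := by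
        ext k
        simp only [Finset.mem_filter, Finset.mem_univ, true_and, Finset.mem_insert,
          Finset.mem_singleton]
        constructor
        · intro hk
          by_contra hcon
          push Not at hcon
          have := face_two P f.2 g.2 k.2 hef heg hk (fun h => hfg (Subtype.ext h))
            (fun h => hcon.1 (Subtype.ext h.symm))
          exact hcon.2 (Subtype.ext this.symm)
        · rintro (rfl | rfl) <;> assumption
      rw [this, Finset.sum_pair hfg]
    have hne : P.faces.Nonempty := by
      have := hP.pentTwelve
      obtain ⟨f, hf⟩ := Finset.card_pos.1 (by omega : 0 < (P.faces.filter fun f => f.card = 5).card)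
      exact ⟨f, (Finset.mem_filter.1 hf).1⟩
    obtain ⟨f0, hf0⟩ := hne
    refine finrank_le_one ⟨fun _ => 1, ?_⟩ ?_
    · rw [LinearMap.mem_ker]
      ext e
      obtain ⟨f, hf, hef, -⟩ := other_face P (f := ∅) e.2
      obtain ⟨g, hg, heg, hgf⟩ := other_face P (f := f) e.2
      rw [Matrix.mulVecLin_apply, hT _ e ⟨f, hf⟩ ⟨g, hg⟩ (fun h => hgf (by simpa using h.symm))
        hef heg]
      rfl
    · rintro ⟨γ, hγ⟩
      rw [LinearMap.mem_ker, Matrix.mulVecLin_apply] at hγ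
      refine ⟨γ ⟨f0, hf0⟩, Subtype.ext ?_⟩
      ext ⟨f, hf⟩
      simp only [SetLike.mk_smul_mk, Pi.smul_apply, smul_eq_mul, mul_one]
      have := dual_const hP (fun k => if hk : k ∈ P.faces then γ ⟨k, hk⟩ else 0) (by
        intro f hf g hg e hef heg hfg
        simp only [hf, hg, dif_pos]
        have := congrFun hγ ⟨e, P.face_edges f hf e hef⟩
        rw [hT _ _ ⟨f, hf⟩ ⟨g, hg⟩ (fun h => hfg (by simpa using h)) hef heg] at this
        exact zmod2_add_eq this) hf0 hf
      simpa [hf, hf0] using this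
  have r1 := LinearMap.finrank_range_add_finrank_ker B.mulVecLin
  have r2 := LinearMap.finrank_range_add_finrank_ker N.mulVecLin
  have r3 := LinearMap.finrank_range_add_finrank_ker N.transpose.mulVecLin
  have r4 := Matrix.rank_transpose N
  simp only [Matrix.rank] at r4
  simp only [Module.finrank_fintype_fun_eq_card, Fintype.card_coe] at r1 r2 r3
  have heu := P.euler
  rw [sum_edges_eq, Nat.card_eq_fintype_card] at heu
  have heq : LinearMap.range B.mulVecLin = LinearMap.ker N.mulVecLin :=
    Submodule.eq_of_le_of_finrank_le hle (by omega)
  have hmem : (fun e : P.graph.edgeSet => if e.1 ∈ S then (1 : ZMod 2) else 0) ∈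
      LinearMap.ker N.mulVecLin := by
    rw [LinearMap.mem_ker, Matrix.mulVecLin_apply]
    ext f
    rw [hNv (fun e => if e ∈ S then 1 else 0) f, Finset.sum_boole, Finset.filter_mem_eq_inter]
    obtain ⟨k, hk⟩ := hS f.1 f.2
    rw [hk]
    push_cast
    exact CharTwo.add_self_eq_zero _
  rw [← heq] at hmem
  obtain ⟨φ, hφ⟩ := hmem
  refine ⟨φ, fun x y h => ?_⟩
  have := congrFun hφ ⟨s(x, y), h⟩
  rw [Matrix.mulVecLin_apply, hBv φ x y h] at this
  exact this

theorem exists_other_edge {P : PlaneGraph V} (hP : IsFullerene P) (x : V) (e e' : Sym2 V) :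
    ∃ y, P.graph.Adj x y ∧ s(x, y) ≠ e ∧ s(x, y) ≠ e' := by
  have h3 := Inc_card hP x
  have : ∃ d ∈ Inc P x, d ∉ ({e, e'} : Finset (Sym2 V)) := by
    by_contra! hcon
    have h := Finset.card_le_card (show Inc P x ⊆ {e, e'} from hcon)
    have := Finset.card_le_two (a := e) (b := e')
    omega
  obtain ⟨d, hd, hde⟩ := this
  obtain ⟨h1, y, rfl⟩ := mem_Inc.1 hd
  simp only [Finset.mem_insert, Finset.mem_singleton, not_or] at hde
  exact ⟨y, h1, hde.1, hde.2⟩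

/-- Two distinct faces share at most one edge. -/
theorem share_one {P : PlaneGraph V} (hP : IsFullerene P) {f g : Finset (Sym2 V)}
    (hf : f ∈ P.faces) (hg : g ∈ P.faces) (hfg : f ≠ g) {e e' : Sym2 V}
    (ef : e ∈ f) (eg : e ∈ g) (ef' : e' ∈ f) (eg' : e' ∈ g) : e = e' := by
  by_contra hne
  obtain ⟨φ, hφ⟩ := exists_cut hP {e, e'} (by
    intro k hk
    by_cases hkfg : k = f ∨ k = g
    · have : k ∩ {e, e'} = {e, e'} := by
        rw [Finset.inter_eq_right]
        intro d hd
        simp only [Finset.mem_insert, Finset.mem_singleton] at hd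
        rcases hkfg with rfl | rfl <;> rcases hd with rfl | rfl <;> assumption
      rw [this, Finset.card_pair hne]
      decide
    · push Not at hkfg
      have : k ∩ {e, e'} = ∅ := by
        refine Finset.eq_empty_of_forall_notMem fun d hd => ?_
        simp only [Finset.mem_inter, Finset.mem_insert, Finset.mem_singleton] at hd
        obtain ⟨hdk, rfl | rfl⟩ := hd
        · exact hkfg.2 (face_two P hf hg hk ef eg hdk hfg hkfg.1.symm).symm
        · exact hkfg.2 (face_two P hf hg hk ef' eg' hdk hfg hkfg.1.symm).symm
      rw [this]; simp)
  have ends : ∀ d ∈ ({e, e'} : Finset (Sym2 V)), ∃ x y, d = s(x, y) ∧ φ x = 1 ∧ φ y = 0 := by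
    intro d hd
    have hdf : d ∈ f := by
      simp only [Finset.mem_insert, Finset.mem_singleton] at hd
      rcases hd with rfl | rfl <;> assumption
    have hdE := P.face_edges f hf d hdf
    induction d with
    | h x y =>
      have h := hφ x y hdE
      rw [if_pos hd] at h
      have : ∀ a b : ZMod 2, a + b = 1 → (a = 1 ∧ b = 0) ∨ (b = 1 ∧ a = 0) := by decide
      rcases this _ _ h with h | h
      · exact ⟨x, y, rfl, h⟩
      · exact ⟨y, x, Sym2.eq_swap, h⟩
  obtain ⟨x, y, rfl, hx, hy⟩ := ends e (by simp)
  obtain ⟨x', y', rfl, hx', hy'⟩ := ends e' (by simp)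
  obtain ⟨z, hz, hz1, hz2⟩ := exists_other_edge hP x s(x, y) s(x', y')
  obtain ⟨u, hu, hu1, hu2⟩ := exists_other_edge hP y' s(x, y) s(x', y')
  have h1 := hφ x z hz
  have h2 := hφ y' u hu
  rw [if_neg (by simp [hz1, hz2, -Sym2.eq])] at h1
  rw [if_neg (by simp [hu1, hu2, -Sym2.eq])] at h2
  have h1 := zmod2_add_eq h1
  have h2 := zmod2_add_eq h2
  rw [hx] at h1
  rw [hy'] at h2
  have hzs : z ∉ ({x, y'} : Set V) := by
    rintro (rfl | rfl)
    · exact hz.ne rfl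
    · rw [hy'] at h1; exact absurd h1 (by decide)
  have hus : u ∉ ({x, y'} : Set V) := by
    rintro (rfl | rfl)
    · rw [hx] at h2; exact absurd h2 (by decide)
    · exact hu.ne rfl
  have := graph_const hP {x, y'} (by
    have := Set.ncard_insert_le x {y'}
    rw [Set.ncard_singleton] at this
    exact this) φ (by
    intro a b ha hb hab
    have h := hφ a b hab
    rw [if_neg] at h
    · exact zmod2_add_eq h
    · intro hmem
      simp only [Finset.mem_insert, Finset.mem_singleton, Sym2.eq_iff] at hmem
      simp only [Set.mem_insert_iff, Set.mem_singleton_iff, not_or] at ha hb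
      rcases hmem with (⟨h, -⟩ | ⟨-, h⟩) | (⟨-, h⟩ | ⟨h, -⟩)
      · exact ha.1 h
      · exact hb.1 h
      · exact hb.2 h
      · exact ha.2 h) hzs hus
  rw [← h1, ← h2] at this
  exact absurd this (by decide)

theorem inter_verts_even {P : PlaneGraph V} (hP : IsFullerene P) {f g : Finset (Sym2 V)}
    (hf : f ∈ P.faces) (hg : g ∈ P.faces) (hfg : f ≠ g) :
    Even (edgeVerts f ∩ edgeVerts g).card := by
  by_cases h : (edgeVerts f ∩ edgeVerts g).Nonempty
  · obtain ⟨x, hx⟩ := h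
    rw [Finset.mem_inter] at hx
    obtain ⟨e, hxe, hef, heg⟩ := common_edge hP hf hg hfg hx.1 hx.2
    have : edgeVerts f ∩ edgeVerts g = Finset.univ.filter fun z => z ∈ e := by
      ext z
      simp only [Finset.mem_inter, Finset.mem_filter, Finset.mem_univ, true_and]
      constructor
      · rintro ⟨h1, h2⟩
        obtain ⟨d, hzd, hdf, hdg⟩ := common_edge hP hf hg hfg h1 h2
        rw [share_one hP hf hg hfg hef heg hdf hdg]
        exact hzd
      · intro hz
        exact ⟨mem_edgeVerts.2 ⟨e, hef, hz⟩, mem_edgeVerts.2 ⟨e, heg, hz⟩⟩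
    rw [this, card_filter_mem_edge (face_not_diag P hf hef)]
    decide
  · rw [Finset.not_nonempty_iff_eq_empty.1 h]; simp

/-- Uncovered vertices of `p` not matched along `p`. -/
def Priv (E : Finset (Sym2 V)) (H : Finset (Finset (Sym2 V))) (M : Finset (Sym2 V))
    (p : Finset (Sym2 V)) : Finset V :=
  (edgeVerts p ∩ Uset E H).filter fun x => ∀ e ∈ M, x ∈ e → e ∉ p

theorem mem_Uset {E : Finset (Sym2 V)} {H : Finset (Finset (Sym2 V))} {x : V} :
    x ∈ Uset E H ↔ x ∈ edgeVerts E ∧ x ∉ facesVerts H := by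
  simp [Uset]

theorem mem_Priv {E : Finset (Sym2 V)} {H : Finset (Finset (Sym2 V))} {M p : Finset (Sym2 V)}
    {x : V} : x ∈ Priv E H M p ↔ x ∈ edgeVerts p ∧ x ∈ Uset E H ∧ ∀ e ∈ M, x ∈ e → e ∉ p := by
  simp [Priv, and_assoc]

theorem Priv_pos {P : PlaneGraph V} (hP : IsFullerene P) {E : Finset (Sym2 V)}
    {H : Finset (Finset (Sym2 V))} {M : Finset (Sym2 V)}
    (hH : ∀ f ∈ H, f ∈ P.faces ∧ f.card = 6 ∧ (f ∩ E).Nonempty)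
    (hHd : ∀ f ∈ H, ∀ g ∈ H, f ≠ g → Disjoint (edgeVerts f) (edgeVerts g))
    (hM : IsMatching M) (hMH : ∀ e ∈ M, ∀ v : V, v ∈ e → v ∉ facesVerts H)
    {p : Finset (Sym2 V)} (hp : p ∈ P.faces) (hp5 : p.card = 5) (hpE : p ⊆ E) :
    0 < (Priv E H M p).card := by
  let A := H.biUnion fun h => edgeVerts p ∩ edgeVerts h
  let B := (M ∩ p).biUnion fun e => Finset.univ.filter fun z => z ∈ e
  have hA : Even A.card := by
    rw [Finset.card_biUnion]
    · refine Finset.even_sum _ fun h hh => inter_verts_even hP hp (hH h hh).1 ?_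
      rintro rfl
      have := (hH p hh).2.1
      omega
    · intro f hf g hg hfg
      exact (hHd f hf g hg hfg).mono Finset.inter_subset_right Finset.inter_subset_right
  have hB : Even B.card := by
    rw [Finset.card_biUnion]
    · refine Finset.even_sum _ fun e he => ?_
      rw [card_filter_mem_edge (hM.1 e (Finset.mem_inter.1 he).1)]
      decide
    · intro e he e' he' hne
      rw [Function.onFun, Finset.disjoint_left]
      intro z hz hz'
      simp only [Finset.mem_filter, Finset.mem_univ, true_and] at hz hz'
      exact hM.2 e (Finset.mem_inter.1 he).1 e' (Finset.mem_inter.1 he').1 hne z hz hz'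
  have hdisj : Disjoint A B := by
    rw [Finset.disjoint_left]
    intro z hz hz'
    simp only [A, B, Finset.mem_biUnion, Finset.mem_inter, Finset.mem_filter, Finset.mem_univ,
      true_and] at hz hz'
    obtain ⟨h, hh, -, hzh⟩ := hz
    obtain ⟨e, ⟨heM, -⟩, hze⟩ := hz'
    exact hMH e heM z hze (mem_facesVerts.2 ⟨h, hh, hzh⟩)
  by_contra hcon
  have hemp : Priv E H M p = ∅ := Finset.card_eq_zero.1 (by omega)
  have hV : edgeVerts p = A ∪ B := by
    ext x
    constructor
    · intro hx
      by_contra hnot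
      rw [Finset.mem_union, not_or] at hnot
      simp only [A, B, Finset.mem_biUnion, Finset.mem_inter, Finset.mem_filter, Finset.mem_univ,
        true_and] at hnot
      have : x ∈ Priv E H M p := by
        rw [mem_Priv, mem_Uset]
        refine ⟨hx, ⟨?_, ?_⟩, ?_⟩
        · obtain ⟨e, he, hxe⟩ := mem_edgeVerts.1 hx
          exact mem_edgeVerts.2 ⟨e, hpE he, hxe⟩
        · intro hxH
          obtain ⟨h, hh, hxh⟩ := mem_facesVerts.1 hxH
          exact hnot.1 ⟨h, hh, hx, hxh⟩
        · intro e he hxe hep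
          exact hnot.2 ⟨e, ⟨he, hep⟩, hxe⟩
      rw [hemp] at this
      simp at this
    · intro hx
      simp only [A, B, Finset.mem_union, Finset.mem_biUnion, Finset.mem_inter, Finset.mem_filter,
        Finset.mem_univ, true_and] at hx
      rcases hx with ⟨h, -, hx, -⟩ | ⟨e, ⟨-, he⟩, hx⟩
      · exact hx
      · exact mem_edgeVerts.2 ⟨e, he, hx⟩
  have h5 := face_card_verts P hp
  rw [hV, Finset.card_union_of_disjoint hdisj, hp5] at h5
  have := hA.add hB
  rw [h5] at this
  exact absurd this (by decide)

/-- In a subgraph, a vertex in two of its faces has degree 3. -/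
theorem deg_three {P : PlaneGraph V} (hP : IsFullerene P) {E : Finset (Sym2 V)}
    (hE : ∀ e ∈ E, e ∈ P.graph.edgeSet) {x : V}
    (h : ∀ e ∈ P.graph.edgeSet, x ∈ e → e ∈ E) : deg E x = 3 := by
  rw [deg, ← Inc_card hP x]
  congr 1
  ext e
  rw [Finset.mem_filter, mem_Inc]
  exact ⟨fun h' => ⟨hE e h'.1, h'.2⟩, fun h' => ⟨h e h'.1 h'.2, h'.2⟩⟩

/-- Consequences of extremality. -/
theorem extremal_struct {P : PlaneGraph V} (hP : IsFullerene P) {E : Finset (Sym2 V)}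
    (hE : ∀ e ∈ E, e ∈ P.graph.edgeSet)
    {H : Finset (Finset (Sym2 V))} {M : Finset (Sym2 V)}
    (hH : ∀ f ∈ H, f ∈ P.faces ∧ f.card = 6 ∧ (f ∩ E).Nonempty)
    (hHd : ∀ f ∈ H, ∀ g ∈ H, f ≠ g → Disjoint (edgeVerts f) (edgeVerts g))
    (hM : IsMatching M) (hMH : ∀ e ∈ M, ∀ v : V, v ∈ e → v ∉ facesVerts H)
    (hM3 : ∀ v ∈ edgeVerts E, deg E v = 3 → v ∉ facesVerts H → ∃ e ∈ M, v ∈ e)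
    (hME : M ⊆ E)
    (hk : (Uset E H).card = (pentFaces P E).card) :
    (∀ p ∈ pentFaces P E, (Priv E H M p).card = 1) ∧
      ∀ x ∈ Uset E H, ∃ p ∈ pentFaces P E, x ∈ Priv E H M p := by
  have hpos : ∀ p ∈ pentFaces P E, 1 ≤ (Priv E H M p).card := by
    intro p hp
    simp only [pentFaces, Finset.mem_filter] at hp
    exact Priv_pos hP hH hHd hM hMH hp.1 hp.2.1 hp.2.2
  have hdisj : ∀ p ∈ pentFaces P E, ∀ q ∈ pentFaces P E, p ≠ q →
      Disjoint (Priv E H M p) (Priv E H M q) := by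
    intro p hp q hq hpq
    simp only [pentFaces, Finset.mem_filter] at hp hq
    rw [Finset.disjoint_left]
    intro x hxp hxq
    rw [mem_Priv] at hxp hxq
    obtain ⟨xp, xU, hxp⟩ := hxp
    obtain ⟨xq, -, hxq⟩ := hxq
    have hd : deg E x = 3 := deg_three hP hE (fun e he hxe => by
      rcases cover_edge hP hp.1 hq.1 hpq xp xq he hxe with h | h
      · exact hp.2.2 h
      · exact hq.2.2 h)
    rw [mem_Uset] at xU
    obtain ⟨e, heM, hxe⟩ := hM3 x xU.1 hd xU.2
    rcases cover_edge hP hp.1 hq.1 hpq xp xq (hE e (hME heM)) hxe with h | h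
    · exact hxp e heM hxe h
    · exact hxq e heM hxe h
  have hsub : (pentFaces P E).biUnion (Priv E H M) ⊆ Uset E H := by
    intro x hx
    rw [Finset.mem_biUnion] at hx
    obtain ⟨p, -, hx⟩ := hx
    exact (mem_Priv.1 hx).2.1
  have hcard : ((pentFaces P E).biUnion (Priv E H M)).card
      = ∑ p ∈ pentFaces P E, (Priv E H M p).card :=
    Finset.card_biUnion fun p hp q hq hpq => hdisj p hp q hq hpq
  have hle := Finset.card_le_card hsub
  have hsum : ∑ p ∈ pentFaces P E, 1 ≤ ∑ p ∈ pentFaces P E, (Priv E H M p).card :=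
    Finset.sum_le_sum hpos
  have hsum1 : ∑ p ∈ pentFaces P E, 1 = (pentFaces P E).card := by simp
  constructor
  · have := (Finset.sum_eq_sum_iff_of_le hpos).1 (by omega)
    intro p hp
    exact (this p hp).symm
  · intro x hx
    have := Finset.eq_of_subset_of_card_le hsub (by omega)
    rw [← this, Finset.mem_biUnion] at hx
    exact hx

/-- The annular structure of a ring of five pentagons. -/
structure Ann (R : ZMod 5 → Finset (Sym2 V)) (a b w : ZMod 5 → V) (s : ZMod 5 → Bool) : Prop where
  spoke : ∀ i, s(a i, b i) ∈ R i
  spoke' : ∀ i, s(a i, b i) ∈ R (i + 1)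
  inn1 : ∀ i, s i = true → s(a (i - 1), w i) ∈ R i
  inn2 : ∀ i, s i = true → s(w i, a i) ∈ R i
  inn3 : ∀ i, s i = true → s(b (i - 1), b i) ∈ R i
  out1 : ∀ i, s i = false → s(b (i - 1), w i) ∈ R i
  out2 : ∀ i, s i = false → s(w i, b i) ∈ R i
  out3 : ∀ i, s i = false → s(a (i - 1), a i) ∈ R i
  wa : ∀ i, w i ≠ a i
  wb : ∀ i, w i ≠ b i
  wa' : ∀ i, w i ≠ a (i - 1)
  wb' : ∀ i, w i ≠ b (i - 1)

theorem Ann.symm {R : ZMod 5 → Finset (Sym2 V)} {a b w : ZMod 5 → V} {s : ZMod 5 → Bool}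
    (h : Ann R a b w s) : Ann R b a w (fun i => !s i) where
  spoke i := by rw [Sym2.eq_swap]; exact h.spoke i
  spoke' i := by rw [Sym2.eq_swap]; exact h.spoke' i
  inn1 i hi := h.out1 i (by simpa using hi)
  inn2 i hi := h.out2 i (by simpa using hi)
  inn3 i hi := h.out3 i (by simpa using hi)
  out1 i hi := h.inn1 i (by simpa using hi)
  out2 i hi := h.inn2 i (by simpa using hi)
  out3 i hi := h.inn3 i (by simpa using hi)
  wa := h.wb
  wb := h.wa
  wa' := h.wb'
  wb' := h.wa'

theorem ring_disj {P : PlaneGraph V} {R : ZMod 5 → Finset (Sym2 V)} (hR : IsPentRing P 5 R)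
    {i j : ZMod 5} (hij : i ≠ j) (h1 : j ≠ i + 1) (h2 : i ≠ j + 1) {x : V}
    (hx : x ∈ edgeVerts (R i)) (hy : x ∈ edgeVerts (R j)) : False := by
  rcases (hR.2.2 i j hij).1 ⟨x, Finset.mem_inter.2 ⟨hx, hy⟩⟩ with h | h
  · exact h1 h
  · exact h2 h

theorem zmod5_a (i : ZMod 5) : i ≠ i + 1 := by revert i; decide
theorem zmod5_b (i : ZMod 5) : i - 1 ≠ i + 1 := by revert i; decide
theorem zmod5_c (i : ZMod 5) : i + 1 ≠ i - 1 + 1 := by revert i; decide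
theorem zmod5_d (i : ZMod 5) : i - 1 ≠ i + 1 + 1 := by revert i; decide
theorem zmod5_e (i : ZMod 5) : i - 1 ≠ i := by revert i; decide
theorem zmod5_f (i : ZMod 5) : i - 1 + 1 = i := by ring

theorem two_edges (P : PlaneGraph V) {f : Finset (Sym2 V)} (hf : f ∈ P.faces) {x : V}
    (hx : x ∈ edgeVerts f) (e : Sym2 V) : ∃ y, s(x, y) ∈ f ∧ s(x, y) ≠ e := by
  have h2 := face_deg P hf hx
  rw [deg] at h2
  obtain ⟨d, hd, hde⟩ := Finset.exists_mem_ne (by omega : 1 < (f.filter fun e => x ∈ e).card) e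
  simp only [Finset.mem_filter] at hd
  obtain ⟨hd, y, rfl⟩ := hd
  exact ⟨y, hd, hde⟩

/-- One pentagon of the ring. -/
theorem pent_side (P : PlaneGraph V) {f : Finset (Sym2 V)} (hf : f ∈ P.faces)
    {a a' b b' w : V} (φ : V → ZMod 2)
    (hV : ∀ x ∈ edgeVerts f, x = a ∨ x = a' ∨ x = b ∨ x = b' ∨ x = w)
    (hs : s(a, b) ∈ f) (hwf : w ∈ edgeVerts f)
    (hφ : ∀ x y, s(x, y) ∈ f → s(x, y) ≠ s(a, b) → s(x, y) ≠ s(a', b') → φ x = φ y)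
    (haa : a ≠ a') (hwa : w ≠ a) (hwb : w ≠ b) (hwa' : w ≠ a') (hwb' : w ≠ b')
    (hb : φ b = φ w) (hb' : φ b' = φ w) (ha : φ a ≠ φ w) (ha' : φ a' ≠ φ w) :
    s(a', a) ∈ f ∧ s(b', w) ∈ f ∧ s(w, b) ∈ f := by
  have key : ∀ y, s(w, y) ∈ f → y = b ∨ y = b' := by
    intro y hy
    have h1 := hφ w y hy (by simp [hwa, hwb]) (by simp [hwa', hwb'])
    have hyw := face_ne P hf hy
    rcases hV y (mem_ev_right hy) with rfl | rfl | rfl | rfl | rfl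
    · exact absurd h1.symm ha
    · exact absurd h1.symm ha'
    · simp
    · simp
    · exact absurd rfl hyw
  refine ⟨?_, ?_, ?_⟩
  · obtain ⟨y, hy, hne⟩ := two_edges P hf (mem_ev_left hs) s(a, b)
    have hya := face_ne P hf hy
    have hab' : a ≠ b' := by rintro rfl; exact ha hb'
    have h1 := hφ a y hy hne (by simp [haa, hab'])
    rcases hV y (mem_ev_right hy) with rfl | rfl | rfl | rfl | rfl
    · exact absurd rfl hya
    · rw [Sym2.eq_swap]; exact hy
    · exact absurd (h1.trans hb) ha
    · exact absurd (h1.trans hb') ha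
    · exact absurd h1 ha
  · obtain ⟨y, hy, hne⟩ := two_edges P hf hwf s(w, b)
    rcases key y hy with rfl | rfl
    · exact absurd rfl hne
    · rw [Sym2.eq_swap]; exact hy
  · obtain ⟨y, hy, hne⟩ := two_edges P hf hwf s(w, b')
    rcases key y hy with rfl | rfl
    · exact hy
    · exact absurd rfl hne

theorem exists_ann {P : PlaneGraph V} (hP : IsFullerene P) {R : ZMod 5 → Finset (Sym2 V)}
    (hR : IsPentRing P 5 R) : ∃ a b w s, Ann R a b w s := by
  have hRf : ∀ i, R i ∈ P.faces := fun i => (hR.2.1 i).1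
  have hRne : ∀ {i j}, i ≠ j → R i ≠ R j := fun h h' => h (hR.1 h')
  have hex : ∀ i, ∃ e, e ∈ R i ∧ e ∈ R (i + 1) := by
    intro i
    obtain ⟨x, hx⟩ := (hR.2.2 i (i + 1) (zmod5_a i)).2 (Or.inl rfl)
    rw [Finset.mem_inter] at hx
    obtain ⟨e, -, h1, h2⟩ := common_edge hP (hRf i) (hRf (i + 1)) (hRne (zmod5_a i)) hx.1 hx.2
    exact ⟨e, h1, h2⟩
  choose e he he' using hex
  have hdis : ∀ i x, x ∈ e i → x ∈ e (i - 1) → False := by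
    intro i x h1 h2
    exact ring_disj hR (i := i - 1) (j := i + 1) (zmod5_b i) (zmod5_c i) (zmod5_d i)
      (mem_edgeVerts.2 ⟨_, he (i - 1), h2⟩) (mem_edgeVerts.2 ⟨_, he' i, h1⟩)
  have hene : ∀ i, e i ≠ e (i - 1) := by
    intro i h
    obtain ⟨x, hx⟩ : ∃ x, x ∈ e i := ⟨(e i).out.1, Sym2.out_fst_mem _⟩
    exact hdis i x hx (h ▸ hx)
  have heface : ∀ i f, f ∈ P.faces → e i ∈ f → f = R i ∨ f = R (i + 1) := by
    intro i f hf hef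
    by_contra hcon
    push Not at hcon
    exact hcon.2 (face_two P (hRf i) (hRf (i + 1)) hf (he i) (he' i) hef (hRne (zmod5_a i))
      hcon.1.symm).symm
  have hein : ∀ i j, e j ∈ R i → j = i ∨ j = i - 1 := by
    intro i j h
    rcases heface j _ (hRf i) h with h | h
    · exact Or.inl (hR.1 h).symm
    · right; rw [hR.1 h]; ring
  have hem1 : ∀ i, e (i - 1) ∈ R i := by
    intro i
    have := he' (i - 1)
    rwa [zmod5_f] at this
  obtain ⟨φ, hφ⟩ := exists_cut hP (Finset.univ.image e) (by
    intro f hf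
    by_cases hfR : ∃ i, f = R i
    · obtain ⟨i, rfl⟩ := hfR
      have : R i ∩ Finset.univ.image e = {e i, e (i - 1)} := by
        ext d
        simp only [Finset.mem_inter, Finset.mem_image, Finset.mem_univ, true_and,
          Finset.mem_insert, Finset.mem_singleton]
        constructor
        · rintro ⟨h1, j, rfl⟩
          rcases hein i j h1 with rfl | rfl <;> simp
        · rintro (rfl | rfl)
          · exact ⟨he i, i, rfl⟩
          · exact ⟨hem1 i, _, rfl⟩
      rw [this, Finset.card_pair (hene i)]
      decide
    · have : f ∩ Finset.univ.image e = ∅ := by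
        refine Finset.eq_empty_of_forall_notMem fun d hd => ?_
        simp only [Finset.mem_inter, Finset.mem_image, Finset.mem_univ, true_and] at hd
        obtain ⟨h1, j, rfl⟩ := hd
        rcases heface j f hf h1 with h | h
        · exact hfR ⟨_, h⟩
        · exact hfR ⟨_, h⟩
      rw [this]; simp)
  have ends : ∀ i, ∃ x y, e i = s(x, y) ∧ φ x = 1 ∧ φ y = 0 := by
    intro i
    have hdE := P.face_edges _ (hRf i) _ (he i)
    have hmem : e i ∈ Finset.univ.image e := Finset.mem_image_of_mem _ (Finset.mem_univ _)
    generalize e i = d at hdE hmem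
    induction d with
    | h x y =>
      have h := hφ x y hdE
      rw [if_pos hmem] at h
      have : ∀ a b : ZMod 2, a + b = 1 → (a = 1 ∧ b = 0) ∨ (b = 1 ∧ a = 0) := by decide
      rcases this _ _ h with h | h
      · exact ⟨x, y, rfl, h⟩
      · exact ⟨y, x, Sym2.eq_swap, h⟩
  choose a b hab ha hb using ends
  have hw : ∀ i, ∃ w ∈ edgeVerts (R i), w ∉ ({a i, a (i - 1), b i, b (i - 1)} : Finset V) := by
    intro i
    by_contra! hcon
    have h := Finset.card_le_card (show edgeVerts (R i) ⊆ _ from hcon)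
    rw [face_card_verts P (hRf i), (hR.2.1 i).2] at h
    have := Finset.card_le_four (a := a i) (b := a (i - 1)) (c := b i) (d := b (i - 1))
    omega
  choose w hwR hw using hw
  simp only [Finset.mem_insert, Finset.mem_singleton, not_or] at hw
  have z01 : (1 : ZMod 2) ≠ 0 := by decide
  have hanb : ∀ i j, a i ≠ b j := by
    intro i j h
    have := ha i
    rw [h, hb j] at this
    exact z01 this.symm
  have haa : ∀ i, a i ≠ a (i - 1) := by
    intro i h
    exact hdis i (a i) (by rw [hab]; simp) (by rw [hab, h]; simp)
  have hbb : ∀ i, b i ≠ b (i - 1) := by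
    intro i h
    exact hdis i (b i) (by rw [hab]; simp) (by rw [hab, h]; simp)
  have hV : ∀ i, edgeVerts (R i) = {w i, a i, a (i - 1), b i, b (i - 1)} := by
    intro i
    symm
    apply Finset.eq_of_subset_of_card_le
    · intro x hx
      simp only [Finset.mem_insert, Finset.mem_singleton] at hx
      have h1 := he i
      have h2 := hem1 i
      rw [hab] at h1 h2
      rcases hx with rfl | rfl | rfl | rfl | rfl
      · exact hwR i
      · exact mem_ev_left h1
      · exact mem_ev_left h2
      · exact mem_ev_right h1
      · exact mem_ev_right h2
    · rw [face_card_verts P (hRf i), (hR.2.1 i).2]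
      rw [Finset.card_insert_of_notMem, Finset.card_insert_of_notMem,
        Finset.card_insert_of_notMem, Finset.card_pair (hbb i)]
      · simp [hanb]
      · simp [hanb, haa]
      · simpa using hw i
  have hφR : ∀ i x y, s(x, y) ∈ R i → s(x, y) ≠ s(a i, b i) →
      s(x, y) ≠ s(a (i - 1), b (i - 1)) → φ x = φ y := by
    intro i x y h h1 h2
    have := hφ x y (P.face_edges _ (hRf i) _ h)
    rw [if_neg] at this
    · exact zmod2_add_eq this
    · intro hmem
      simp only [Finset.mem_image, Finset.mem_univ, true_and] at hmem
      obtain ⟨j, hj⟩ := hmem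
      rw [← hj] at h h1 h2
      rcases hein i j h with rfl | rfl
      · exact h1 (hab _)
      · exact h2 (hab _)
  have hsp : ∀ i, s(a i, b i) ∈ R i := fun i => hab i ▸ he i
  have z2 : ∀ z : ZMod 2, z ≠ 1 → z = 0 := by decide
  have inn : ∀ i, φ (w i) = 1 →
      s(b (i - 1), b i) ∈ R i ∧ s(a (i - 1), w i) ∈ R i ∧ s(w i, a i) ∈ R i := by
    intro i hi
    refine pent_side P (hRf i) φ ?_ ?_ (hwR i) ?_ (hbb i) (hw i).2.2.1 (hw i).1 (hw i).2.2.2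
      (hw i).2.1 ?_ ?_ ?_ ?_
    · intro x hx
      rw [hV i] at hx
      simp only [Finset.mem_insert, Finset.mem_singleton] at hx
      tauto
    · rw [Sym2.eq_swap]; exact hsp i
    · intro x y h h1 h2
      rw [Sym2.eq_swap (a := b _)] at h1 h2
      exact hφR i x y h h1 h2
    · rw [hi, ha]
    · rw [hi, ha]
    · rw [hi, hb]; exact z01.symm
    · rw [hi, hb]; exact z01.symm
  have out : ∀ i, φ (w i) = 0 →
      s(a (i - 1), a i) ∈ R i ∧ s(b (i - 1), w i) ∈ R i ∧ s(w i, b i) ∈ R i := by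
    intro i hi
    refine pent_side P (hRf i) φ ?_ (hsp i) (hwR i) (hφR i) (haa i) (hw i).1 (hw i).2.2.1
      (hw i).2.1 (hw i).2.2.2 ?_ ?_ ?_ ?_
    · intro x hx
      rw [hV i] at hx
      simp only [Finset.mem_insert, Finset.mem_singleton] at hx
      tauto
    · rw [hi, hb]
    · rw [hi, hb]
    · rw [hi, ha]; exact z01
    · rw [hi, ha]; exact z01
  refine ⟨a, b, w, fun i => decide (φ (w i) = 1), ?_⟩
  constructor
  · exact hsp
  · exact fun i => hab i ▸ he' i
  · exact fun i hi => (inn i (by simpa using hi)).2.1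
  · exact fun i hi => (inn i (by simpa using hi)).2.2
  · exact fun i hi => (inn i (by simpa using hi)).1
  · exact fun i hi => (out i (z2 _ (by simpa using hi))).2.1
  · exact fun i hi => (out i (z2 _ (by simpa using hi))).2.2
  · exact fun i hi => (out i (z2 _ (by simpa using hi))).1
  · exact fun i => (hw i).1
  · exact fun i => (hw i).2.2.1
  · exact fun i => (hw i).2.1
  · exact fun i => (hw i).2.2.2

theorem zmod5_g (i : ZMod 5) : i = i + 4 + 1 := by revert i; decide

theorem pattern (s : ZMod 5 → Bool) : ∃ c : Bool,
    (∀ i, s i = c) ∨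
    (∃ i, s i = !c ∧ s (i + 1) = c ∧ s (i + 2) = c ∧ s (i + 3) = c ∧ s (i + 4) = c) ∨
    (∃ i, s i = !c ∧ s (i + 1) = !c ∧ s (i + 2) = c ∧ s (i + 3) = c ∧ s (i + 4) = c) ∨
    (∃ i, s i = !c ∧ s (i + 1) = c ∧ s (i + 2) = !c ∧ s (i + 3) = c ∧ s (i + 4) = c) := by
  revert s; decide

theorem closed_at (P : PlaneGraph V) {f : Finset (Sym2 V)} (hf : f ∈ P.faces) {y u v : V}
    (hu : s(y, u) ∈ f) (hv : s(y, v) ∈ f) (huv : u ≠ v) (z : V) (hz : s(y, z) ∈ f) :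
    z = u ∨ z = v := by
  rcases face_only P hf hu hv hz (fun h => huv (Sym2.congr_right.1 h)) (x := y)
    (by simp) (by simp) (by simp) with h | h
  · exact Or.inl (Sym2.congr_right.1 h)
  · exact Or.inr (Sym2.congr_right.1 h)

theorem swap_mem {E : Finset (Sym2 V)} {x y : V} (h : s(x, y) ∈ E) : s(y, x) ∈ E := by
  rw [Sym2.eq_swap]; exact h

/-- The conclusion about the inside of the ring. -/
theorem ann_center {P : PlaneGraph V} (hP : IsFullerene P) {R : ZMod 5 → Finset (Sym2 V)}
    (hR : IsPentRing P 5 R) {a b w : ZMod 5 → V} {s : ZMod 5 → Bool} (hA : Ann R a b w s)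
    (hpat : (∀ i, s i = false) ∨
    (∃ i, s i = true ∧ s (i + 1) = false ∧ s (i + 2) = false ∧ s (i + 3) = false ∧
      s (i + 4) = false) ∨
    (∃ i, s i = true ∧ s (i + 1) = true ∧ s (i + 2) = false ∧ s (i + 3) = false ∧
      s (i + 4) = false) ∨
    (∃ i, s i = true ∧ s (i + 1) = false ∧ s (i + 2) = true ∧ s (i + 3) = false ∧
      s (i + 4) = false)) :
    ∃ C ∈ P.faces, C.card = 5 ∧ Function.Injective a ∧ (∀ i, C ≠ R i) ∧
      (∀ i, s(a (i - 1), a i) ∈ C ∧ s(a (i - 1), a i) ∈ R i) := by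
  have hRf : ∀ i, R i ∈ P.faces := fun i => (hR.2.1 i).1
  have hRne : ∀ {i j}, i ≠ j → R i ≠ R j := fun h h' => h (hR.1 h')
  have haR : ∀ i, a i ∈ edgeVerts (R i) := fun i => mem_ev_left (hA.spoke i)
  have haR' : ∀ i, a i ∈ edgeVerts (R (i + 1)) := fun i => mem_ev_left (hA.spoke' i)
  have haR'' : ∀ i, a (i - 1) ∈ edgeVerts (R i) := fun i => by
    have := haR' (i - 1); rwa [zmod5_f] at this
  have hsp'' : ∀ i, s(a (i - 1), b (i - 1)) ∈ R i := fun i => by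
    have := hA.spoke' (i - 1); rwa [zmod5_f] at this
  have far : ∀ i x, x ∈ edgeVerts (R (i - 1)) → x ∈ edgeVerts (R (i + 1)) → False :=
    fun i x h1 h2 => ring_disj hR (zmod5_b i) (zmod5_c i) (zmod5_d i) h1 h2
  have far2 : ∀ i x, x ∈ edgeVerts (R i) → x ∈ edgeVerts (R (i + 2)) → False := by
    intro i x h1 h2
    have e1 : i = i + 1 - 1 := by ring
    have e2 : i + 2 = i + 1 + 1 := by ring
    rw [e2] at h2
    exact far (i + 1) x (e1 ▸ h1) h2
  have hinj : Function.Injective a := by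
    intro i j hij
    by_contra hne
    have key : ∀ i j : ZMod 5, i ≠ j → j = i + 1 ∨ j = i + 2 ∨ i = j + 1 ∨ i = j + 2 := by decide
    rcases key i j hne with rfl | rfl | rfl | rfl
    · refine far2 i (a i) (haR i) ?_
      rw [hij]
      have := haR' (i + 1)
      rwa [show i + 1 + 1 = i + 2 by ring] at this
    · exact far2 i (a i) (haR i) (hij ▸ haR (i + 2))
    · refine far2 j (a j) (haR j) ?_
      rw [← hij]
      have := haR' (j + 1)
      rwa [show j + 1 + 1 = j + 2 by ring] at this
    · exact far2 j (a j) (haR j) (hij ▸ haR (j + 2))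
  have hg : ∀ i, ∃ h ∈ P.faces, h ≠ R i ∧ h ≠ R (i + 1) ∧ a i ∈ edgeVerts h := fun i =>
    exists_third hP (hRf i) (hRf (i + 1)) (hRne (zmod5_a i)) (haR i) (haR' i)
  choose g hgf hg1 hg2 hga using hg
  have hg2' : ∀ i, g (i - 1) ≠ R i := fun i => by
    have := hg2 (i - 1); rwa [zmod5_f] at this
  -- edges of `R i` at `a i` and `a (i-1)`
  have e1 : ∀ i x, s(x, a i) ∈ R i → s(x, a i) ∉ R (i + 1) → s(x, a i) ∈ g i := by
    intro i x h1 h2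
    exact third_edge hP (hRf i) (hRf (i + 1)) (hgf i) (hg2 i).symm (haR' i) (hga i) h1
      (by simp) h2
  have e2 : ∀ i x, s(a (i - 1), x) ∈ R i → s(a (i - 1), x) ∉ R (i - 1) →
      s(a (i - 1), x) ∈ g (i - 1) := by
    intro i x h1 h2
    exact third_edge hP (hRf i) (hRf (i - 1)) (hgf (i - 1)) (hg1 (i - 1)).symm (haR (i - 1))
      (hga (i - 1)) h1 (by simp) h2
  have f1 : ∀ i, s i = false → s(a (i - 1), a i) ∈ g i := fun i hi =>
    e1 i _ (hA.out3 i hi) fun h => far i _ (haR (i - 1)) (mem_ev_left h)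
  have f2 : ∀ i, s i = false → s(a (i - 1), a i) ∈ g (i - 1) := fun i hi =>
    e2 i _ (hA.out3 i hi) fun h => far i _ (mem_ev_right h) (haR' i)
  have f3 : ∀ i, s i = false → g (i - 1) = g i := fun i hi =>
    face_two P (hRf i) (hgf (i - 1)) (hgf i) (hA.out3 i hi) (f2 i hi) (f1 i hi)
      (hg2' i).symm (hg1 i).symm
  have t0 : ∀ i, s i = true → s(w i, a i) ∉ R (i + 1) := by
    intro i hi h
    have := share_one hP (hRf i) (hRf (i + 1)) (hRne (zmod5_a i)) (hA.inn2 i hi) h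
      (hA.spoke i) (hA.spoke' i)
    rw [Sym2.eq_iff] at this
    rcases this with h | h
    · exact hA.wa i h.1
    · exact hA.wb i h.1
  have t1 : ∀ i, s i = true → s(w i, a i) ∈ g i := fun i hi => e1 i _ (hA.inn2 i hi) (t0 i hi)
  have t2 : ∀ i, s i = true → s(a (i - 1), w i) ∈ g (i - 1) := by
    intro i hi
    refine e2 i _ (hA.inn1 i hi) fun h => ?_
    have := share_one hP (hRf (i - 1)) (hRf i) (hRne (zmod5_e i)) h (hA.inn1 i hi)
      (hA.spoke (i - 1)) (hsp'' i)
    rw [Sym2.eq_iff] at this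
    rcases this with h | h
    · exact hA.wb' i h.2
    · exact hA.wa' i h.2
  have t3 : ∀ i, s i = true → g (i - 1) ≠ g i := by
    intro i hi h
    have h1 := t2 i hi
    rw [h] at h1
    have := share_one hP (hRf i) (hgf i) (hg1 i).symm (hA.inn1 i hi) h1 (hA.inn2 i hi) (t1 i hi)
    rw [Sym2.eq_iff] at this
    rcases this with h | h
    · exact hA.wa i h.2
    · exact zmod5_e i (hinj h.1)
  have F3 : ∀ i j, j = i + 1 → s j = false → g i = g j := by
    rintro i _ rfl h
    have := f3 (i + 1) h
    rwa [add_sub_cancel_right] at this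
  have T3 : ∀ i j, j = i + 1 → s j = true → g i ≠ g j := by
    rintro i _ rfl h
    have := t3 (i + 1) h
    rwa [add_sub_cancel_right] at this
  have T2 : ∀ i j, j = i + 1 → s j = true → s(a i, w j) ∈ g i := by
    rintro i _ rfl h
    have := t2 (i + 1) h
    rwa [add_sub_cancel_right] at this
  have small : ∀ f ∈ P.faces, ∀ (S : Finset V) (x : V), x ∈ edgeVerts f → x ∈ S → S.card ≤ 4 →
      (∀ y z, s(y, z) ∈ f → y ∈ S → z ∈ S) → False := by
    intro f hf S x hx hxS hc hcl
    have h1 := Finset.card_le_card (face_closed P hf S hx hxS hcl)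
    rw [face_card_verts P hf] at h1
    have := hP.faceSize f hf
    omega
  have chord : ∀ f ∈ P.faces, ∀ h ∈ P.faces, f ≠ h → ∀ x y, x ≠ y → x ∈ edgeVerts f →
      x ∈ edgeVerts h → y ∈ edgeVerts f → y ∈ edgeVerts h → s(x, y) ∈ f := by
    intro f hf h hh hne x y hxy xf xh yf yh
    obtain ⟨t, hxt, htf, hth⟩ := common_edge hP hf hh hne xf xh
    obtain ⟨t', hyt, htf', hth'⟩ := common_edge hP hf hh hne yf yh
    have := share_one hP hf hh hne htf hth htf' hth'
    subst this
    rwa [← (Sym2.mem_and_mem_iff hxy).1 ⟨hxt, hyt⟩]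
  rcases hpat with h0 | ⟨i, h0, h1, h2, h3, h4⟩ | ⟨i, h0, h1, h2, h3, h4⟩ | ⟨i, h0, h1, h2, h3, h4⟩
  · have hconst : ∀ i, g i = g 0 := by
      have c1 := F3 0 1 (by decide) (h0 _)
      have c2 := F3 1 2 (by decide) (h0 _)
      have c3 := F3 2 3 (by decide) (h0 _)
      have c4 := F3 3 4 (by decide) (h0 _)
      have key : ∀ i : ZMod 5, i = 0 ∨ i = 1 ∨ i = 2 ∨ i = 3 ∨ i = 4 := by decide
      intro i
      rcases key i with rfl | rfl | rfl | rfl | rfl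
      · rfl
      · exact c1.symm
      · exact (c1.trans c2).symm
      · exact (c1.trans (c2.trans c3)).symm
      · exact (c1.trans (c2.trans (c3.trans c4))).symm
    have hed : ∀ i, s(a (i - 1), a i) ∈ g 0 := fun i => hconst i ▸ f1 i (h0 i)
    refine ⟨g 0, hgf 0, ?_, hinj, ?_, fun i => ⟨hed i, hA.out3 i (h0 i)⟩⟩
    · have hcl := face_closed P (hgf 0) (Finset.univ.image a) (hga 0)
        (Finset.mem_image_of_mem _ (Finset.mem_univ _)) (by
        intro y z hyz hy
        simp only [Finset.mem_image, Finset.mem_univ, true_and] at hy ⊢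
        obtain ⟨i, rfl⟩ := hy
        have h' := hed (i + 1)
        rw [add_sub_cancel_right] at h'
        rcases closed_at P (hgf 0) (swap_mem (hed i)) h'
          (fun h => zmod5_b i (hinj h)) z hyz with h | h
        · exact ⟨_, h.symm⟩
        · exact ⟨_, h.symm⟩)
      have h1 := Finset.card_le_card hcl
      rw [face_card_verts P (hgf 0)] at h1
      have h2 : (Finset.univ.image a).card ≤ (Finset.univ : Finset (ZMod 5)).card :=
        Finset.card_image_le
      rw [Finset.card_univ, ZMod.card] at h2
      have := hP.faceSize _ (hgf 0)
      omega
    · intro i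
      rw [← hconst i]
      exact hg1 i
  · exfalso
    have c1 := F3 i (i + 1) rfl h1
    have c2 := F3 (i + 1) (i + 2) (by ring) h2
    have c3 := F3 (i + 2) (i + 3) (by ring) h3
    have c4 := F3 (i + 3) (i + 4) (by ring) h4
    exact T3 (i + 4) i (zmod5_g i) h0 (c1.trans (c2.trans (c3.trans c4))).symm
  · exfalso
    have c2 := F3 (i + 1) (i + 2) (by ring) h2
    have c3 := F3 (i + 2) (i + 3) (by ring) h3
    have c4 := F3 (i + 3) (i + 4) (by ring) h4
    have c := c2.trans (c3.trans c4)
    have k1 := t1 i h0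
    have k2 := T2 i (i + 1) rfl h1
    have k3 := t1 (i + 1) h1
    have k4 := T2 (i + 4) i (zmod5_g i) h0
    rw [← c] at k4
    have hww : w i ≠ w (i + 1) := by
      intro h
      have := hA.inn1 (i + 1) h1
      rw [add_sub_cancel_right, ← h] at this
      exact t0 i h0 (swap_mem this)
    have hch := chord (g i) (hgf i) (g (i + 1)) (hgf _) (T3 i (i + 1) rfl h1) _ _ hww
      (mem_ev_left k1) (mem_ev_right k4) (mem_ev_right k2) (mem_ev_left k3)
    refine small (g i) (hgf i) {w i, a i, w (i + 1)} (a i) (hga i) (by simp)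
      (Finset.card_le_three.trans (by omega)) ?_
    intro y z hyz hy
    simp only [Finset.mem_insert, Finset.mem_singleton] at hy ⊢
    have wa1 := hA.wa' (i + 1)
    rw [add_sub_cancel_right] at wa1
    rcases hy with rfl | rfl | rfl
    · rcases closed_at P (hgf i) k1 hch wa1.symm z hyz with h | h <;> simp [h]
    · rcases closed_at P (hgf i) (swap_mem k1) k2 hww z hyz with h | h <;> simp [h]
    · rcases closed_at P (hgf i) (swap_mem k2) (swap_mem hch) (hA.wa i).symm z hyz with h | h <;>
        simp [h]
  · exfalso
    have c1 := F3 i (i + 1) rfl h1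
    have c3 := F3 (i + 2) (i + 3) (by ring) h3
    have c4 := F3 (i + 3) (i + 4) (by ring) h4
    have c := c3.trans c4
    have k1 := t1 i h0
    have k2 := T2 (i + 1) (i + 2) (by ring) h2
    rw [← c1] at k2
    have k0 := f2 (i + 1) h1
    rw [add_sub_cancel_right] at k0
    have k3 := t1 (i + 2) h2
    have k4 := T2 (i + 4) i (zmod5_g i) h0
    rw [← c] at k4
    have hne := T3 (i + 1) (i + 2) (by ring) h2
    rw [← c1] at hne
    have hwR : ∀ j, s j = true → w j ∈ edgeVerts (R j) := fun j hj => mem_ev_left (hA.inn2 j hj)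
    have hww : w i ≠ w (i + 2) := by
      intro h
      exact far2 i (w i) (hwR i h0) (h ▸ hwR (i + 2) h2)
    have hwa1 : w i ≠ a (i + 1) := by
      intro h
      have := haR' (i + 1)
      rw [show i + 1 + 1 = i + 2 by ring] at this
      exact far2 i (w i) (hwR i h0) (h ▸ this)
    have hwa2 : a i ≠ w (i + 2) := by
      intro h
      exact far2 i (a i) (haR i) (h ▸ hwR (i + 2) h2)
    have hch := chord (g i) (hgf i) (g (i + 2)) (hgf _) hne _ _ hww
      (mem_ev_left k1) (mem_ev_right k4) (mem_ev_right k2) (mem_ev_left k3)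
    have hwa3 : w (i + 2) ≠ a (i + 1) := by
      have := hA.wa' (i + 2)
      rwa [show i + 2 - 1 = i + 1 by ring] at this
    refine small (g i) (hgf i) {w i, a i, a (i + 1), w (i + 2)} (a i) (hga i) (by simp)
      Finset.card_le_four ?_
    intro y z hyz hy
    simp only [Finset.mem_insert, Finset.mem_singleton] at hy ⊢
    rcases hy with rfl | rfl | rfl | rfl
    · rcases closed_at P (hgf i) k1 hch hwa2 z hyz with h | h <;> simp [h]
    · rcases closed_at P (hgf i) (swap_mem k1) k0 hwa1 z hyz with h | h <;> simp [h]
    · rcases closed_at P (hgf i) (swap_mem k0) k2 hwa2 z hyz with h | h <;> simp [h]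
    · rcases closed_at P (hgf i) (swap_mem k2) (swap_mem hch) hwa1.symm z hyz with h | h <;>
        simp [h]

theorem ring_center {P : PlaneGraph V} (hP : IsFullerene P) {R : ZMod 5 → Finset (Sym2 V)}
    (hR : IsPentRing P 5 R) :
    ∃ (c o : ZMod 5 → V), ∃ C ∈ P.faces, C.card = 5 ∧ Function.Injective c ∧ (∀ i, C ≠ R i) ∧
      (∀ i, s(c (i - 1), c i) ∈ C ∧ s(c (i - 1), c i) ∈ R i) ∧
      (∀ i, s(c i, o i) ∈ R i ∧ s(c i, o i) ∈ R (i + 1)) := by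
  obtain ⟨a, b, w, s, hA⟩ := exists_ann hP hR
  obtain ⟨c, hc⟩ := pattern s
  cases c
  · obtain ⟨C, hC, h1, h2, h3, h4⟩ := ann_center hP hR hA hc
    exact ⟨a, b, C, hC, h1, h2, h3, h4, fun i => ⟨hA.spoke i, hA.spoke' i⟩⟩
  · obtain ⟨C, hC, h1, h2, h3, h4⟩ := ann_center hP hR hA.symm (by simpa using hc)
    exact ⟨b, a, C, hC, h1, h2, h3, h4, fun i => ⟨hA.symm.spoke i, hA.symm.spoke' i⟩⟩

theorem pattern2 (X : ZMod 5 → Bool) (h : ∀ i, ¬ (X i = true ∧ X (i + 1) = true)) :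
    (∃ i, X (i + 2) = true ∧ X (i + 4) = true) ∨
    ∃ i j, i ≠ j ∧ X i = false ∧ X (i + 1) = false ∧ X j = false ∧ X (j + 1) = false := by
  revert X; decide

theorem not_extremal_aux {P : PlaneGraph V} (hP : IsFullerene P) (E : Finset (Sym2 V))
    (hE : ∀ e ∈ E, e ∈ P.graph.edgeSet)
    (R : ZMod 5 → Finset (Sym2 V)) (hR : IsPentRing P 5 R) (v : V)
    (hv : deg ((Finset.univ : Finset (ZMod 5)).sup R) v = 2)
    (hsub : ∀ e ∈ (Finset.univ : Finset (ZMod 5)).sup R, v ∉ e → e ∈ E) :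
    ¬IsExtremalSub P E := by
  rintro ⟨H, ⟨⟨hH, hHd, M, hME, hM, hMH, hM3⟩, -⟩, hk⟩
  obtain ⟨hone, hall⟩ := extremal_struct hP hE hH hHd hM hMH hM3 hME hk
  obtain ⟨c, o, C, hC, hC5, hinj, hCR, hcc, hco⟩ := ring_center hP hR
  have hRf : ∀ i, R i ∈ P.faces := fun i => (hR.2.1 i).1
  have hRne : ∀ {i j}, i ≠ j → R i ≠ R j := fun h h' => h (hR.1 h')
  have hmemsup : ∀ {e i}, e ∈ R i → e ∈ (Finset.univ : Finset (ZMod 5)).sup R := by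
    intro e i h
    rw [Finset.mem_sup]
    exact ⟨i, Finset.mem_univ _, h⟩
  -- vertices in two ring faces are not `v`
  have hvne : ∀ x i, x ∈ edgeVerts (R i) → x ∈ edgeVerts (R (i + 1)) → x ≠ v := by
    rintro x i h1 h2 rfl
    have : deg ((Finset.univ : Finset (ZMod 5)).sup R) x = 3 := deg_three hP (by
      intro e he
      rw [Finset.mem_sup] at he
      obtain ⟨j, -, he⟩ := he
      exact P.face_edges _ (hRf j) e he) (by
      intro e he hxe
      rcases cover_edge hP (hRf i) (hRf (i + 1)) (hRne (zmod5_a i)) h1 h2 he hxe with h | h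
      · exact hmemsup h
      · exact hmemsup h)
    omega
  have hcR : ∀ i, c i ∈ edgeVerts (R i) := fun i => mem_ev_left (hco i).1
  have hcR' : ∀ i, c i ∈ edgeVerts (R (i + 1)) := fun i => mem_ev_left (hco i).2
  have hcC : ∀ i, c i ∈ edgeVerts C := fun i => mem_ev_right (hcc i).1
  have hcv : ∀ i, c i ≠ v := fun i => hvne _ i (hcR i) (hcR' i)
  have hov : ∀ i, o i ≠ v := fun i => hvne _ i (mem_ev_right (hco i).1) (mem_ev_right (hco i).2)
  have hccE : ∀ i, s(c (i - 1), c i) ∈ E := fun i =>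
    hsub _ (hmemsup (hcc i).2) (by simp [(hcv _).symm])
  have hcoE : ∀ i, s(c i, o i) ∈ E := fun i =>
    hsub _ (hmemsup (hco i).1) (by simp [(hcv _).symm, (hov _).symm])
  have hcc' : ∀ i, s(c i, c (i + 1)) ∈ C ∧ s(c i, c (i + 1)) ∈ R (i + 1) := by
    intro i
    have := hcc (i + 1)
    rwa [add_sub_cancel_right] at this
  have hccE' : ∀ i, s(c i, c (i + 1)) ∈ E := by
    intro i
    have := hccE (i + 1)
    rwa [add_sub_cancel_right] at this
  -- edges at `c i`
  have hCed : ∀ i e, e ∈ C → c i ∈ e → e = s(c (i - 1), c i) ∨ e = s(c i, c (i + 1)) := by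
    intro i e he hce
    refine face_only P hC (hcc i).1 (hcc' i).1 he ?_ (x := c i) (by simp) (by simp) hce
    intro h
    rw [Sym2.eq_swap] at h
    exact zmod5_b i (hinj (Sym2.congr_right.1 h))
  have hspokeC : ∀ i, s(c i, o i) ∉ C := by
    intro i h
    exact hRne (zmod5_a i) (face_two P hC (hRf i) (hRf (i + 1)) h (hco i).1 (hco i).2
      (hCR _) (hCR _))
  have hed : ∀ i e, e ∈ P.graph.edgeSet → c i ∈ e →
      e = s(c (i - 1), c i) ∨ e = s(c i, c (i + 1)) ∨ e = s(c i, o i) := by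
    intro i e he hce
    by_cases heC : e ∈ C
    · rcases hCed i e heC hce with h | h <;> simp [h]
    · have h1 := (cover_edge hP hC (hRf i) (hCR i) (hcC i) (hcR i) he hce).resolve_left heC
      have h2 := (cover_edge hP hC (hRf (i + 1)) (hCR _) (hcC i) (hcR' i) he hce).resolve_left heC
      right; right
      exact share_one hP (hRf i) (hRf (i + 1)) (hRne (zmod5_a i)) h1 h2 (hco i).1 (hco i).2
  have hCE : C ⊆ E := by
    have hVC : edgeVerts C ⊆ Finset.univ.image c :=
      face_closed P hC (Finset.univ.image c) (hcC 0)
        (Finset.mem_image_of_mem _ (Finset.mem_univ _)) (by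
        intro y z hyz hy
        simp only [Finset.mem_image, Finset.mem_univ, true_and] at hy ⊢
        obtain ⟨i, rfl⟩ := hy
        rcases closed_at P hC (swap_mem (hcc i).1) (hcc' i).1
          (fun h => zmod5_b i (hinj h)) z hyz with h | h
        · exact ⟨_, h.symm⟩
        · exact ⟨_, h.symm⟩)
    intro e he
    have hx : e.out.1 ∈ edgeVerts C := mem_edgeVerts.2 ⟨e, he, Sym2.out_fst_mem e⟩
    have hx' := hVC hx
    simp only [Finset.mem_image, Finset.mem_univ, true_and] at hx'
    obtain ⟨i, hi⟩ := hx'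
    have hce : c i ∈ e := hi ▸ Sym2.out_fst_mem e
    rcases hCed i e he hce with rfl | rfl
    · exact hccE i
    · exact hccE' i
  have hCp : C ∈ pentFaces P E := by
    simp only [pentFaces, Finset.mem_filter]
    exact ⟨hC, hC5, hCE⟩
  have hfaces : ∀ i k, k ∈ P.faces → c i ∈ edgeVerts k → k = C ∨ k = R i ∨ k = R (i + 1) :=
    fun i k hk hx => four_faces hP hC (hRf i) (hRf (i + 1)) hk (hCR _) (hCR _)
      (hRne (zmod5_a i)) (hcC i) (hcR i) (hcR' i) hx
  have hcH : ∀ i, c i ∉ facesVerts H := by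
    intro i h
    obtain ⟨k, hk, hx⟩ := mem_facesVerts.1 h
    have h6 := (hH k hk).2.1
    rcases hfaces i k (hH k hk).1 hx with rfl | rfl | rfl
    · omega
    · have := (hR.2.1 i).2; omega
    · have := (hR.2.1 (i + 1)).2; omega
  have hcE : ∀ i, c i ∈ edgeVerts E := fun i => mem_ev_left (hcoE i)
  have hcU : ∀ i, c i ∈ Uset E H := fun i => mem_Uset.2 ⟨hcE i, hcH i⟩
  have hmatch : ∀ i, ∃ e ∈ M, c i ∈ e := fun i =>
    hM3 _ (hcE i) (deg_three hP hE (by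
      intro e he hce
      rcases hed i e he hce with rfl | rfl | rfl
      · exact hccE i
      · exact hccE' i
      · exact hcoE i)) (hcH i)
  have huniq : ∀ x e e', e ∈ M → e' ∈ M → x ∈ e → x ∈ e' → e = e' := by
    intro x e e' h1 h2 h3 h4
    by_contra hne
    exact hM.2 e h1 e' h2 hne x h3 h4
  have hpriv1 : ∀ p ∈ pentFaces P E, ∀ x y, x ∈ Priv E H M p → y ∈ Priv E H M p → x = y := by
    intro p hp x y hx hy
    exact Finset.card_le_one.1 (hone p hp).le x hx y hy
  rcases pattern2 (fun i => decide (s(c (i - 1), c i) ∈ M)) (by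
    rintro i ⟨h1, h2⟩
    simp only [decide_eq_true_eq] at h1 h2
    have h := huniq (c i) _ _ h1 h2 (by simp) (by simp)
    rw [add_sub_cancel_right, Sym2.eq_swap] at h
    exact zmod5_b i (hinj (Sym2.congr_right.1 h))) with ⟨i, h2, h4⟩ | ⟨i, j, hij, h1, h2, h3, h4⟩
  · simp only [decide_eq_true_eq] at h2 h4
    -- `c (i+2)` is private to `R (i+3)`
    obtain ⟨p, hp, hcp⟩ := hall _ (hcU (i + 2))
    obtain ⟨q, hq, hcq⟩ := hall _ (hcU (i + 3))
    have e3 : i + 2 + 1 = i + 3 := by ring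
    have e4 : i + 3 + 1 = i + 4 := by ring
    have e4' : i + 4 - 1 = i + 3 := by ring
    have hpe : p = R (i + 3) := by
      have hx := mem_Priv.1 hcp
      have hno := hx.2.2 _ h2 (by simp)
      rcases hfaces _ p (Finset.mem_filter.1 hp).1 hx.1 with rfl | rfl | rfl
      · exact absurd (hcc _).1 hno
      · exact absurd (hcc _).2 hno
      · rw [e3]
    have hqe : q = R (i + 3) := by
      have hx := mem_Priv.1 hcq
      have hno := hx.2.2 _ h4 (by simp [e4'])
      rcases hfaces _ q (Finset.mem_filter.1 hq).1 hx.1 with rfl | rfl | rfl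
      · exact absurd (hcc _).1 hno
      · rfl
      · rw [e4] at hno
        exact absurd (hcc _).2 hno
    rw [hqe, ← hpe] at hcq
    have := hinj (hpriv1 p hp _ _ hcp hcq)
    rw [← e3] at this
    exact zmod5_a _ this
  · simp only [decide_eq_false_iff_not] at h1 h2 h3 h4
    rw [add_sub_cancel_right] at h2 h4
    have key : ∀ i, s(c (i - 1), c i) ∉ M → s(c i, c (i + 1)) ∉ M → c i ∈ Priv E H M C := by
      intro i h1 h2
      refine mem_Priv.2 ⟨hcC i, hcU i, ?_⟩
      intro e he hce heC
      rcases hCed i e heC hce with rfl | rfl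
      · exact h1 he
      · exact h2 he
    exact hij (hinj (hpriv1 C hCp _ _ (key i h1 h2) (key j h3 h4)))

/-- Lemma 3.5. Let `G` be a subgraph of a fullerene graph `F_n` with
`n ≥ 40`. If `R_5⁻ ⊆ G` — where `R_5⁻` arises from the pentagonal ring `R_5` by deleting
one 2-degree vertex `v` together with its two incident edges — then `G` is not
extremal. -/
theorem statement_8 (P : PlaneGraph V) (hP : IsFullerene P)
    (hn : 40 ≤ Fintype.card V) (E : Finset (Sym2 V))
    (hE : ∀ e ∈ E, e ∈ P.graph.edgeSet)
    (R : ZMod 5 → Finset (Sym2 V)) (hR : IsPentRing P 5 R) (v : V)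
    (hv : deg ((Finset.univ : Finset (ZMod 5)).sup R) v = 2)
    (hsub : ∀ e ∈ (Finset.univ : Finset (ZMod 5)).sup R, v ∉ e → e ∈ E) :
    ¬IsExtremalSub P E :=
  not_extremal_aux hP E hE R hR v hv hsub

end FG
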